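/- arXiv:1101.0645 — 10 statements merged into one kernel-verified Lean document; each statement's English description precedes it below -/
import Mathlib

section
/- For r ≥ 1, the two-dimensional serendipity space is the span of the polynomials of total degree at most r together with the two monomials x₁x₂^r and x₁^r x₂: a real polynomial in two variables has superlinear degree at most r if and only if it lies in P_r(ℝ²) + span{x₁x₂^r, x₁^r x₂}. -/
/-- The superlinear degree of a monomial with exponent vector `α`. -/
def slDeg {σ : Type*} [Fintype σ] (α : σ →₀ ℕ) : ℕ :=
  ∑ i, if 2 ≤ α i then α i else 0

/-- In two variables, the exponents of superlinear degree at most `r` are those of total degree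
at most `r` together with `(1, r)` and `(r, 1)`. -/
theorem setOf_slDeg_fin_two_le {r : ℕ} (hr : 1 ≤ r) :
    {α : Fin 2 →₀ ℕ | slDeg α ≤ r} = {α | (α.sum fun _ e => e) ≤ r} ∪
      {Finsupp.single 0 1 + Finsupp.single 1 r, Finsupp.single 0 r + Finsupp.single 1 1} := by
  ext α
  have hsum : (α.sum fun _ e => e) = α 0 + α 1 := by
    rw [Finsupp.sum_fintype _ _ (by simp), Fin.sum_univ_two]
  simp only [Set.mem_ofPred_eq, Set.mem_union, Set.mem_insert_iff, Set.mem_singleton_iff, slDeg,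
    hsum, Fin.sum_univ_two, Finsupp.ext_iff, Fin.forall_fin_two, Finsupp.add_apply,
    Finsupp.single_apply, zero_ne_one, one_ne_zero, if_true, if_false, add_zero, zero_add]
  split_ifs <;> omega

/-- `S_r(I²) = P_r(I²) + span{x₁x₂ʳ, x₁ʳx₂}`: a polynomial in two variables has
superlinear degree at most `r` iff it is the sum of a polynomial of total degree at
most `r` and a linear combination of `x₁x₂ʳ` and `x₁ʳx₂`. -/
theorem serendipity_two_dim (r : ℕ) (hr : 1 ≤ r) (p : MvPolynomial (Fin 2) ℝ) :
    (∀ α ∈ p.support, slDeg α ≤ r) ↔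
      p ∈ MvPolynomial.restrictTotalDegree (Fin 2) ℝ r ⊔
        Submodule.span ℝ {MvPolynomial.X 0 * MvPolynomial.X 1 ^ r,
          MvPolynomial.X 0 ^ r * MvPolynomial.X 1} := by
  have key : MvPolynomial.restrictSupport ℝ {α : Fin 2 →₀ ℕ | slDeg α ≤ r} =
      MvPolynomial.restrictTotalDegree (Fin 2) ℝ r ⊔
        Submodule.span ℝ {MvPolynomial.X 0 * MvPolynomial.X 1 ^ r,
          MvPolynomial.X 0 ^ r * MvPolynomial.X 1} := by
    rw [setOf_slDeg_fin_two_le hr, MvPolynomial.restrictTotalDegree,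
      MvPolynomial.restrictSupport_eq_span, MvPolynomial.restrictSupport_eq_span,
      Set.image_union, Submodule.span_union, Set.image_pair]
    simp [MvPolynomial.X, MvPolynomial.monomial_pow, MvPolynomial.monomial_mul]
  rw [← key]
  exact Iff.rfl
end

section
/- For n ≥ 1 and r ≥ 1, the dimension of the serendipity space S_r(n) is given by dim S_r(n) = Σ_{d=0}^{min(n,⌊r/2⌋)} 2^{n−d} · C(n,d) · C(r−d,d). Equivalently, the number of multi-indices α ∈ ℕ^n with Σ_{i : α_i ≥ 2} α_i ≤ r equals Σ_{d=0}^{min(n,⌊r/2⌋)} 2^{n−d} · C(n,d) · C(r−d,d). -/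
/-- The serendipity space `S_r(n)`: polynomials in `n` variables all of whose
monomials have superlinear degree at most `r`. -/
noncomputable def serendipity (n r : ℕ) : Submodule ℝ (MvPolynomial (Fin n) ℝ) where
  carrier := {p | ∀ α ∈ p.support, slDeg α ≤ r}
  add_mem' := by
    intro a b ha hb α hα
    rcases Finset.mem_union.mp (MvPolynomial.support_add hα) with h | h
    · exact ha α h
    · exact hb α h
  zero_mem' := by simp
  smul_mem' := by
    intro t p hp α hα
    exact hp α (MvPolynomial.support_smul hα)

/-- The contribution of a single exponent to the superlinear degree. -/
def slWeight (a : ℕ) : ℕ := if 2 ≤ a then a else 0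

theorem slDeg_eq_slWeight_add_tail {n : ℕ} (α : Fin (n + 1) →₀ ℕ) :
    slDeg α = slWeight (α 0) + slDeg α.tail := by
  rw [slDeg, Fin.sum_univ_succ]
  rfl

theorem lt_of_slWeight_le {a r : ℕ} (h : slWeight a ≤ r) : a < r - 1 + 2 := by
  unfold slWeight at h
  split_ifs at h <;> omega

/-- Multi-indices in `n + 1` variables, split by the exponent of the first variable. -/
noncomputable def slDegLeEquiv (n r : ℕ) :
    {α : Fin (n + 1) →₀ ℕ // slDeg α ≤ r} ≃
      Σ a : Fin (r - 1 + 2), {β : Fin n →₀ ℕ // slWeight a + slDeg β ≤ r} where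
  toFun α :=
    have h : slWeight (α.1 0) + slDeg α.1.tail ≤ r := slDeg_eq_slWeight_add_tail α.1 ▸ α.2
    ⟨⟨α.1 0, lt_of_slWeight_le (le_of_add_le_left h)⟩, α.1.tail, h⟩
  invFun p := ⟨Finsupp.cons (p.1 : ℕ) p.2.1, by
    simpa [slDeg_eq_slWeight_add_tail] using p.2.2⟩
  left_inv α := by simp
  right_inv p := by
    obtain ⟨⟨a, ha⟩, β, hβ⟩ := p
    have h : (Finsupp.cons a β).tail = β := Finsupp.tail_cons a β
    simp only [Finsupp.cons_zero]
    congr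

theorem finite_slDeg_le (n r : ℕ) : Finite {α : Fin n →₀ ℕ // slDeg α ≤ r} := by
  induction n with
  | zero => infer_instance
  | succ n ih =>
    have (a : ℕ) : Finite {β : Fin n →₀ ℕ // a + slDeg β ≤ r} :=
      Set.Finite.subset (s := {β : Fin n →₀ ℕ | slDeg β ≤ r}) ih
        fun _ h => le_of_add_le_right (show a + slDeg _ ≤ r from h)
    exact Finite.of_equiv _ (slDegLeEquiv n r).symm

theorem card_slDeg_le_of_slWeight_le {n r a : ℕ} (h : slWeight a ≤ r) :
    Nat.card {β : Fin n →₀ ℕ // slWeight a + slDeg β ≤ r} =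
      Nat.card {β : Fin n →₀ ℕ // slDeg β ≤ r - slWeight a} :=
  Nat.card_congr (Equiv.subtypeEquivRight fun _ => by omega)

theorem card_slDeg_le_succ (n r : ℕ) :
    Nat.card {α : Fin (n + 1) →₀ ℕ // slDeg α ≤ r} =
      2 * Nat.card {α : Fin n →₀ ℕ // slDeg α ≤ r} +
        ∑ j ∈ Finset.range (r - 1), Nat.card {α : Fin n →₀ ℕ // slDeg α ≤ j} := by
  have (a : ℕ) : Finite {β : Fin n →₀ ℕ // a + slDeg β ≤ r} :=
    Set.Finite.subset (s := {β : Fin n →₀ ℕ | slDeg β ≤ r}) (finite_slDeg_le n r)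
      fun _ h => le_of_add_le_right (show a + slDeg _ ≤ r from h)
  rw [Nat.card_congr (slDegLeEquiv n r), Nat.card_sigma,
    Fin.sum_univ_eq_sum_range
      (fun a => Nat.card {β : Fin n →₀ ℕ // slWeight a + slDeg β ≤ r}),
    Finset.sum_range_succ', Finset.sum_range_succ',
    ← Finset.sum_range_reflect (fun j => Nat.card {α : Fin n →₀ ℕ // slDeg α ≤ j})]
  have hsum : ∑ k ∈ Finset.range (r - 1),
        Nat.card {β : Fin n →₀ ℕ // slWeight (k + 1 + 1) + slDeg β ≤ r} =
      ∑ k ∈ Finset.range (r - 1),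
        Nat.card {β : Fin n →₀ ℕ // slDeg β ≤ r - 1 - 1 - k} := by
    refine Finset.sum_congr rfl fun k hk => ?_
    have hk := Finset.mem_range.mp hk
    have hw : slWeight (k + 1 + 1) = k + 2 := by simp [slWeight]
    rw [card_slDeg_le_of_slWeight_le (by omega), hw, show r - (k + 2) = r - 1 - 1 - k by omega]
  rw [hsum]
  simp only [slWeight]
  norm_num
  ring

theorem sum_range_choose_sub (d m : ℕ) :
    ∑ j ∈ Finset.range m, (j - d).choose d = (m - d).choose (d + 1) := by
  induction m with
  | zero => simp
  | succ m ih =>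
    rw [Finset.sum_range_succ, ih]
    rcases le_or_gt d m with h | h
    · rw [Nat.succ_sub h, Nat.choose_succ_succ, add_comm]
    · rw [Nat.sub_eq_zero_of_le h.le, Nat.sub_eq_zero_of_le h,
        Nat.choose_eq_zero_of_lt (by omega : 0 < d), add_zero]

theorem sum_choose_recurrence (n r : ℕ) :
    ∑ d ∈ Finset.range (n + 2), 2 ^ (n + 1 - d) * (n + 1).choose d * (r - d).choose d =
      2 * ∑ d ∈ Finset.range (n + 1), 2 ^ (n - d) * n.choose d * (r - d).choose d +
        ∑ j ∈ Finset.range (r - 1),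
          ∑ d ∈ Finset.range (n + 1), 2 ^ (n - d) * n.choose d * (j - d).choose d := by
  have hdouble : 2 * ∑ d ∈ Finset.range (n + 1), 2 ^ (n - d) * n.choose d * (r - d).choose d =
      ∑ d ∈ Finset.range (n + 2), 2 ^ (n + 1 - d) * n.choose d * (r - d).choose d := by
    rw [Finset.sum_range_succ _ (n + 1), Nat.choose_succ_self, Finset.mul_sum]
    simp only [mul_zero, zero_mul, add_zero]
    refine Finset.sum_congr rfl fun d hd => ?_
    rw [Nat.succ_sub (Nat.lt_succ_iff.mp (Finset.mem_range.mp hd)), pow_succ]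
    ring
  rw [hdouble, Finset.sum_comm]
  simp_rw [← Finset.mul_sum, sum_range_choose_sub]
  rw [Finset.sum_range_succ', Finset.sum_range_succ' _ (n + 1), add_right_comm,
    ← Finset.sum_add_distrib]
  congr 1
  · refine Finset.sum_congr rfl fun d _ => ?_
    rw [Nat.choose_succ_succ, Nat.add_sub_add_right, Nat.sub_sub, add_comm 1 d]
    ring
  · simp

theorem card_slDeg_le (n r : ℕ) :
    Nat.card {α : Fin n →₀ ℕ // slDeg α ≤ r} =
      ∑ d ∈ Finset.range (n + 1), 2 ^ (n - d) * n.choose d * (r - d).choose d := by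
  induction n generalizing r with
  | zero =>
    have : Nonempty {α : Fin 0 →₀ ℕ // slDeg α ≤ r} := ⟨0, by simp [slDeg]⟩
    rw [Nat.card_unique]
    simp
  | succ n ih =>
    rw [card_slDeg_le_succ, sum_choose_recurrence]
    simp_rw [ih]

theorem sum_range_min_half (n r : ℕ) :
    ∑ d ∈ Finset.range (min n (r / 2) + 1), 2 ^ (n - d) * n.choose d * (r - d).choose d =
      ∑ d ∈ Finset.range (n + 1), 2 ^ (n - d) * n.choose d * (r - d).choose d := by
  refine Finset.sum_subset (Finset.range_mono (by omega)) fun d hd hd' => ?_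
  simp only [Finset.mem_range] at hd hd'
  rw [Nat.choose_eq_zero_of_lt (by omega : r - d < d), mul_zero]

theorem serendipity_eq_restrictSupport (n r : ℕ) :
    serendipity n r = MvPolynomial.restrictSupport ℝ {α | slDeg α ≤ r} :=
  rfl

theorem finrank_serendipity (n r : ℕ) :
    Module.finrank ℝ (serendipity n r) = Nat.card {α : Fin n →₀ ℕ // slDeg α ≤ r} := by
  rw [serendipity_eq_restrictSupport]
  exact Module.finrank_eq_nat_card_basis (MvPolynomial.basisRestrictSupport ℝ _)

/-- The dimension formula `dim S_r(n) = Σ_{d=0}^{min(n,⌊r/2⌋)} 2^{n-d} C(n,d) C(r-d,d)`;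
equivalently, this counts the multi-indices of superlinear degree at most `r`. -/
theorem serendipity_dim (n r : ℕ) (hn : 1 ≤ n) (hr : 1 ≤ r) :
    Module.finrank ℝ (serendipity n r) =
      ∑ d ∈ Finset.range (min n (r / 2) + 1), 2 ^ (n - d) * n.choose d * (r - d).choose d ∧
    Nat.card {α : Fin n →₀ ℕ // slDeg α ≤ r} =
      ∑ d ∈ Finset.range (min n (r / 2) + 1), 2 ^ (n - d) * n.choose d * (r - d).choose d := by
  rw [finrank_serendipity, sum_range_min_half]
  exact ⟨card_slDeg_le n r, card_slDeg_le n r⟩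
end

section
/- (Unisolvence, Theorem 2.2.) Let n ≥ 1, r ≥ 1, and let u be a real polynomial in n variables with superlinear degree at most r. Suppose that for every face f of the cube [−1,1]^n — specified by a subset J ⊆ {1,…,n} and signs c_j ∈ {−1,1} for j ∈ J, with dimension d = n − #J — and for every real polynomial q in the variables x_i, i ∉ J, of total degree at most r − 2d, the moment ∫_f u·q vanishes, where the integral is over the face f = {x ∈ [−1,1]^n : x_j = c_j for j ∈ J} with respect to d-dimensional Lebesgue measure (for d = 0 the moment is the value of u at the vertex). Then u = 0. -/
open MeasureTheory

namespace MvPolynomial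

variable {σ : Type*}

lemma one_sub_X_sq_ne_zero (j : σ) : (1 - X j ^ 2 : MvPolynomial σ ℝ) ≠ 0 := by
  intro h
  simpa using congrArg (eval fun _ => (0 : ℝ)) h

lemma prod_one_sub_X_sq_ne_zero (T : Finset σ) :
    (∏ j ∈ T, (1 - X j ^ 2) : MvPolynomial σ ℝ) ≠ 0 :=
  Finset.prod_ne_zero_iff.2 fun j _ => one_sub_X_sq_ne_zero j

lemma totalDegree_prod_one_sub_X_sq_mul_le (T : Finset σ) (v : MvPolynomial σ ℝ) :
    ((∏ j ∈ T, (1 - X j ^ 2)) * v).totalDegree ≤ 2 * T.card + v.totalDegree := by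
  refine (totalDegree_mul _ _).trans (Nat.add_le_add_right ?_ _)
  refine (totalDegree_finsetProd _ _).trans ?_
  rw [mul_comm, ← smul_eq_mul]
  refine Finset.sum_le_card_nsmul _ _ _ fun j _ => ?_
  refine (totalDegree_sub _ _).trans ?_
  simp

variable [DecidableEq σ]

/-- Substitute the constants `c j` for the variables `X j`, `j ∈ J`. -/
noncomputable def freeze (J : Finset σ) (c : σ → ℝ) : MvPolynomial σ ℝ →ₐ[ℝ] MvPolynomial σ ℝ :=
  aeval fun i => if i ∈ J then C (c i) else X i

lemma freeze_X_of_notMem {J : Finset σ} {i : σ} (h : i ∉ J) (c : σ → ℝ) :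
    freeze J c (X i) = X i := by
  simp [freeze, h]

lemma freeze_X_of_mem {J : Finset σ} {i : σ} (h : i ∈ J) (c : σ → ℝ) :
    freeze J c (X i) = C (c i) := by
  simp [freeze, h]

lemma freeze_empty (c : σ → ℝ) (p : MvPolynomial σ ℝ) : freeze ∅ c p = p := by
  simp [freeze]

lemma freeze_freeze (J : Finset σ) (c : σ → ℝ) (p : MvPolynomial σ ℝ) :
    freeze J c (freeze J c p) = freeze J c p := by
  have : (freeze J c).comp (freeze J c) = freeze J c := by
    ext1 i
    by_cases h : i ∈ J
    · simp [freeze_X_of_mem h, ← algebraMap_eq]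
    · simp [freeze_X_of_notMem h]
  exact DFunLike.congr_fun this p

lemma freeze_singleton_freeze {J : Finset σ} {j : σ} (hj : j ∉ J) (c : σ → ℝ) (a : ℝ)
    (p : MvPolynomial σ ℝ) :
    freeze {j} (fun _ => a) (freeze J c p) = freeze (insert j J) (Function.update c j a) p := by
  have : (freeze {j} (fun _ => a)).comp (freeze J c) =
      freeze (insert j J) (Function.update c j a) := by
    ext1 i
    by_cases h : i ∈ J
    · have hij : i ≠ j := by rintro rfl; exact hj h
      simp [freeze_X_of_mem h, freeze_X_of_mem (Finset.mem_insert_of_mem h), hij, ← algebraMap_eq]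
    · by_cases hij : i = j
      · subst hij
        simp [freeze_X_of_notMem h, freeze_X_of_mem]
      · simp [freeze_X_of_notMem, h, hij]
  exact DFunLike.congr_fun this p

lemma eval_freeze (J : Finset σ) (c x : σ → ℝ) (p : MvPolynomial σ ℝ) :
    eval x (freeze J c p) = eval (fun i => if i ∈ J then c i else x i) p := by
  have : (aeval x).comp (freeze J c) = aeval (R := ℝ) (fun i => if i ∈ J then c i else x i) := by
    ext1 i
    by_cases h : i ∈ J
    · simp [freeze_X_of_mem h, h]
    · simp [freeze_X_of_notMem h, h]
  simpa [coe_aeval_eq_eval] using DFunLike.congr_fun this p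

lemma exists_freeze_monomial (J : Finset σ) (c : σ → ℝ) (α : σ →₀ ℕ) (a : ℝ) :
    ∃ b, freeze J c (monomial α a) = monomial (α.filter (· ∉ J)) b := by
  induction α using Finsupp.induction_linear generalizing a with
  | zero =>
    refine ⟨a, ?_⟩
    rw [Finsupp.filter_zero, ← C_apply, ← algebraMap_eq, AlgHom.commutes]
  | add α β hα hβ =>
    obtain ⟨b, hb⟩ := hα a
    obtain ⟨b', hb'⟩ := hβ 1
    refine ⟨b * b', ?_⟩
    have : monomial (α + β) a = monomial α a * monomial β 1 := by simp
    rw [this, map_mul, hb, hb', monomial_mul, Finsupp.filter_add]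
  | single i k =>
    rw [← C_mul_X_pow_eq_monomial, map_mul, map_pow, ← algebraMap_eq, AlgHom.commutes]
    by_cases h : i ∈ J
    · refine ⟨a * c i ^ k, ?_⟩
      rw [freeze_X_of_mem h, Finsupp.filter_single_of_neg _ (by simpa using h)]
      simp [← C_apply, algebraMap_eq]
    · refine ⟨a, ?_⟩
      rw [freeze_X_of_notMem h, Finsupp.filter_single_of_pos (· ∉ J) h, algebraMap_eq,
        C_mul_X_pow_eq_monomial]

lemma exists_of_mem_support_freeze {J : Finset σ} {c : σ → ℝ} {p : MvPolynomial σ ℝ}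
    {β : σ →₀ ℕ} (hβ : β ∈ (freeze J c p).support) :
    ∃ α ∈ p.support, β = α.filter (· ∉ J) := by
  rw [p.as_sum, map_sum] at hβ
  obtain ⟨α, hα, h⟩ := Finset.mem_biUnion.1 (support_sum hβ)
  obtain ⟨b, hb⟩ := exists_freeze_monomial J c α (coeff α p)
  rw [hb] at h
  exact ⟨α, hα, Finset.mem_singleton.1 (support_monomial_subset h)⟩

lemma X_sub_C_dvd_of_freeze_eq_zero {j : σ} {a : ℝ} {p : MvPolynomial σ ℝ}
    (h : freeze {j} (fun _ => a) p = 0) : X j - C a ∣ p := by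
  have key : (Ideal.Quotient.mkₐ ℝ (Ideal.span {X j - C a})).comp (freeze {j} (fun _ => a)) =
      Ideal.Quotient.mkₐ ℝ (Ideal.span {X j - C a}) := by
    ext1 i
    by_cases hij : i = j
    · subst hij
      rw [AlgHom.comp_apply, freeze_X_of_mem (Finset.mem_singleton_self i)]
      refine (Ideal.Quotient.eq.2 ?_).symm
      exact Ideal.mem_span_singleton_self _
    · rw [AlgHom.comp_apply, freeze_X_of_notMem (by simpa using hij)]
  have hp := DFunLike.congr_fun key p
  rw [AlgHom.comp_apply, h, map_zero] at hp
  exact Ideal.mem_span_singleton.1 (Ideal.Quotient.eq_zero_iff_mem.1 hp.symm)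

lemma freeze_prod_one_sub_X_sq {J T : Finset σ} (h : Disjoint J T) (c : σ → ℝ) :
    freeze J c (∏ j ∈ T, (1 - X j ^ 2)) = ∏ j ∈ T, (1 - X j ^ 2) := by
  rw [map_prod]
  refine Finset.prod_congr rfl fun j hj => ?_
  simp [freeze_X_of_notMem (Finset.disjoint_right.1 h hj)]

lemma one_sub_X_sq_dvd {j : σ} {p : MvPolynomial σ ℝ} (h₁ : freeze {j} (fun _ => 1) p = 0)
    (h₂ : freeze {j} (fun _ => -1) p = 0) : 1 - X j ^ 2 ∣ p := by
  obtain ⟨q, rfl⟩ := X_sub_C_dvd_of_freeze_eq_zero h₁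
  have hne : freeze {j} (fun _ => -1) (X j - C 1) ≠ 0 := by
    intro h
    rw [map_sub, freeze_X_of_mem (Finset.mem_singleton_self j), ← algebraMap_eq, AlgHom.commutes,
      ← map_sub, algebraMap_eq, C_eq_zero] at h
    norm_num at h
  rw [map_mul] at h₂
  obtain ⟨s, rfl⟩ := X_sub_C_dvd_of_freeze_eq_zero ((mul_eq_zero.1 h₂).resolve_left hne)
  exact ⟨-s, by simp only [map_neg, map_one]; ring⟩

lemma prod_one_sub_X_sq_dvd {T : Finset σ} {p : MvPolynomial σ ℝ}
    (h₁ : ∀ j ∈ T, freeze {j} (fun _ => 1) p = 0)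
    (h₂ : ∀ j ∈ T, freeze {j} (fun _ => -1) p = 0) : ∏ j ∈ T, (1 - X j ^ 2) ∣ p := by
  induction T using Finset.induction_on with
  | empty => simp
  | insert j T hj ih =>
    obtain ⟨v, rfl⟩ := ih (fun i hi => h₁ i (Finset.mem_insert_of_mem hi))
      (fun i hi => h₂ i (Finset.mem_insert_of_mem hi))
    have hv (a : ℝ) (h : freeze {j} (fun _ => a) ((∏ i ∈ T, (1 - X i ^ 2)) * v) = 0) :
        freeze {j} (fun _ => a) v = 0 := by
      rw [map_mul, freeze_prod_one_sub_X_sq (by simpa using hj)] at h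
      exact (mul_eq_zero.1 h).resolve_left (prod_one_sub_X_sq_ne_zero T)
    rw [Finset.prod_insert hj, mul_comm]
    exact mul_dvd_mul_left _ (one_sub_X_sq_dvd (hv 1 (h₁ j (Finset.mem_insert_self j T)))
      (hv (-1) (h₂ j (Finset.mem_insert_self j T))))

lemma coeff_prod_one_sub_X_sq_mul {v : MvPolynomial σ ℝ} {α : σ →₀ ℕ}
    (hα : α.degree = v.totalDegree) (T : Finset σ) :
    coeff (α + ∑ j ∈ T, Finsupp.single j 2) ((∏ j ∈ T, (1 - X j ^ 2)) * v) =
      (-1) ^ T.card * coeff α v := by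
  induction T using Finset.induction_on with
  | empty => simp
  | insert j T hj ih =>
    have hdeg : (α + ∑ j ∈ T, Finsupp.single j 2).degree = 2 * T.card + v.totalDegree := by
      simp [hα, map_sum, mul_comm, add_comm]
    have hz : coeff (α + ∑ j ∈ T, Finsupp.single j 2 + Finsupp.single j 2)
        ((∏ j ∈ T, (1 - X j ^ 2)) * v) = 0 := by
      apply coeff_eq_zero_of_totalDegree_lt
      refine (totalDegree_prod_one_sub_X_sq_mul_le T v).trans_lt ?_
      rw [← Finsupp.degree_apply, map_add, hdeg]
      simp
    rw [Finset.prod_insert hj, Finset.sum_insert hj, Finset.card_insert_of_notMem hj,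
      add_comm (Finsupp.single j 2), ← add_assoc, mul_assoc, sub_mul, one_mul, coeff_sub, hz,
      mul_comm (X j ^ 2), X_pow_eq_monomial, coeff_mul_monomial, ih]
    ring

lemma eq_zero_of_setIntegral_prod_one_sub_sq_eq_zero {n : ℕ} {J : Finset (Fin n)} {c : Fin n → ℝ}
    {v : MvPolynomial (Fin n) ℝ} (hv : freeze J c v = v)
    (h : ∫ y in (Set.Icc (fun _ => (-1 : ℝ)) (fun _ => 1) : Set ({j : Fin n // j ∉ J} → ℝ)),
      eval (fun i => if h : i ∈ J then c i else y ⟨i, h⟩)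
        ((∏ j ∈ Jᶜ, (1 - X j ^ 2)) * v * v) = 0) : v = 0 := by
  set e : ({j : Fin n // j ∉ J} → ℝ) → Fin n → ℝ :=
    fun y i => if h : i ∈ J then c i else y ⟨i, h⟩ with he
  set f : ({j : Fin n // j ∉ J} → ℝ) → ℝ :=
    fun y => eval (e y) ((∏ j ∈ Jᶜ, (1 - X j ^ 2)) * v * v) with hf
  have hfe (y) : f y = (∏ j ∈ Jᶜ, (1 - e y j ^ 2)) * (eval (e y) v) ^ 2 := by
    simp [hf, sq, mul_assoc]
  have hecont : Continuous e := by
    refine continuous_pi fun i => ?_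
    by_cases hi : i ∈ J
    · simp [he, hi, continuous_const]
    · simpa [he, hi] using continuous_apply _
  have hcont : Continuous f := (continuous_eval _).comp hecont
  have hnonneg : ∀ y ∈ Set.Icc (fun _ => (-1 : ℝ)) (fun _ => 1), 0 ≤ f y := by
    intro y hy
    rw [hfe]
    refine mul_nonneg (Finset.prod_nonneg fun j hj => ?_) (sq_nonneg _)
    have hj' : j ∉ J := Finset.mem_compl.1 hj
    have h1 := hy.1 ⟨j, hj'⟩
    have h2 := hy.2 ⟨j, hj'⟩
    simp only [he, hj', dif_neg, not_false_eq_true]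
    simp only at h1 h2
    nlinarith
  have hae : f =ᵐ[volume.restrict (Set.Icc (fun _ => (-1 : ℝ)) (fun _ => 1))] 0 :=
    (setIntegral_eq_zero_iff_of_nonneg_ae
      ((ae_restrict_iff' measurableSet_Icc).2 (ae_of_all _ hnonneg))
      (hcont.continuousOn.integrableOn_compact isCompact_Icc)).1 h
  have hsub : Set.univ.pi (fun _ : {j : Fin n // j ∉ J} => Set.Ioo (-1 : ℝ) 1) ⊆
      Set.Icc (fun _ => (-1 : ℝ)) (fun _ => 1) := fun y hy =>
    ⟨fun i => (hy i trivial).1.le, fun i => (hy i trivial).2.le⟩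
  have hzero : Set.EqOn f 0 (Set.univ.pi fun _ => Set.Ioo (-1 : ℝ) 1) :=
    Measure.eqOn_open_of_ae_eq (ae_restrict_of_ae_restrict_of_subset hsub hae)
      (isOpen_set_pi Set.finite_univ fun _ _ => isOpen_Ioo) hcont.continuousOn continuousOn_const
  refine funext_set (fun _ => Set.Ioo (-1 : ℝ) 1) (fun _ => Set.Ioo_infinite (by norm_num)) ?_
  intro x hx
  set y : {j : Fin n // j ∉ J} → ℝ := fun i => x i.1 with hy
  have hxe : e y = fun i => if i ∈ J then c i else x i := by
    ext i
    by_cases hi : i ∈ J <;> simp [he, hy, hi]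
  have hfy : f y = 0 := hzero fun i _ => hx i.1 trivial
  rw [hfe, hxe, ← eval_freeze, hv] at hfy
  rw [map_zero]
  refine pow_eq_zero_iff two_ne_zero |>.1 ((mul_eq_zero.1 hfy).resolve_left ?_)
  refine Finset.prod_ne_zero_iff.2 fun j hj => ?_
  have := hx j trivial
  simp only [Finset.mem_compl.1 hj, if_false]
  nlinarith [this.1, this.2]

end MvPolynomial

lemma slDeg_filter_le {σ : Type*} [Fintype σ] (α : σ →₀ ℕ) (P : σ → Prop) [DecidablePred P] :
    slDeg (α.filter P) ≤ slDeg α := by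
  refine Finset.sum_le_sum fun i _ => ?_
  by_cases h : P i <;> simp [h]

lemma slDeg_add_sum_single_two {σ : Type*} [Fintype σ] [DecidableEq σ] {α : σ →₀ ℕ}
    {T : Finset σ} (h : ∀ j ∉ T, α j = 0) :
    slDeg (α + ∑ j ∈ T, Finsupp.single j 2) = α.degree + 2 * T.card := by
  have hs (i : σ) : (∑ j ∈ T, Finsupp.single j 2 : σ →₀ ℕ) i = if i ∈ T then 2 else 0 := by
    simp [Finsupp.finsetSum_apply, Finsupp.single_apply]
  have : 2 * T.card = ∑ i, if i ∈ T then 2 else 0 := by simp [mul_comm]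
  rw [Finsupp.degree_eq_sum, this, ← Finset.sum_add_distrib]
  refine Finset.sum_congr rfl fun i _ => ?_
  rw [Finsupp.add_apply, hs]
  by_cases hi : i ∈ T
  · simp [hi]
  · simp [hi, h i hi]

/-- Unisolvence of the serendipity degrees of freedom (Theorem 2.2).
If `u` has superlinear degree at most `r` and, for every face `f` of `[-1,1]^n`
(given by a set `J` of frozen indices and signs `c j = ±1` for `j ∈ J`, of dimension
`d = n - #J`) and every polynomial `q` in the free variables of `f` with total degree
at most `r - 2d`, the moment `∫_f u·q` vanishes, then `u = 0`. -/
theorem serendipity_unisolvence (n r : ℕ) (hn : 1 ≤ n) (hr : 1 ≤ r)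
    (u : MvPolynomial (Fin n) ℝ) (hu : ∀ α ∈ u.support, slDeg α ≤ r)
    (hmom : ∀ (J : Finset (Fin n)) (c : Fin n → ℝ),
      (∀ j ∈ J, c j = 1 ∨ c j = -1) →
      ∀ q : MvPolynomial (Fin n) ℝ,
        (∀ α ∈ q.support, ∀ j ∈ J, α j = 0) →
        (q.totalDegree : ℤ) ≤ (r : ℤ) - 2 * ((n : ℤ) - J.card) →
        ∫ y in (Set.Icc (fun _ => (-1 : ℝ)) (fun _ => 1) : Set ({j : Fin n // j ∉ J} → ℝ)),
          MvPolynomial.eval (fun i => if h : i ∈ J then c i else y ⟨i, h⟩) (u * q) = 0) :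
    u = 0 := by
  suffices H : ∀ (k : ℕ) (J : Finset (Fin n)) (c : Fin n → ℝ), Jᶜ.card = k →
      (∀ j ∈ J, c j = 1 ∨ c j = -1) → MvPolynomial.freeze J c u = 0 by
    simpa [MvPolynomial.freeze_empty] using H _ ∅ (fun _ => 1) rfl (by simp)
  intro k
  induction k using Nat.strong_induction_on with
  | _ k ih =>
  intro J c hk hc
  have hfacet (a : ℝ) (ha : a = 1 ∨ a = -1) (j : Fin n) (hj : j ∈ Jᶜ) :
      MvPolynomial.freeze {j} (fun _ => a) (MvPolynomial.freeze J c u) = 0 := by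
    have hjJ : j ∉ J := Finset.mem_compl.1 hj
    rw [MvPolynomial.freeze_singleton_freeze hjJ]
    refine ih _ ?_ _ _ rfl fun i hi => ?_
    · rw [← hk]
      exact Finset.card_lt_card
        (Finset.compl_ssubset_compl.2 (Finset.ssubset_insert hjJ))
    · by_cases hij : i = j
      · subst hij
        simpa using ha
      · simpa [hij] using hc i (Finset.mem_of_mem_insert_of_ne hi hij)
  obtain ⟨v, hv⟩ := MvPolynomial.prod_one_sub_X_sq_dvd (hfacet 1 (Or.inl rfl))
    (hfacet (-1) (Or.inr rfl))
  have hvfix : MvPolynomial.freeze J c v = v := by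
    have h := MvPolynomial.freeze_freeze J c u
    rw [hv, map_mul, MvPolynomial.freeze_prod_one_sub_X_sq disjoint_compl_right] at h
    exact mul_left_cancel₀ (MvPolynomial.prod_one_sub_X_sq_ne_zero _) h
  have hvJ : ∀ α ∈ v.support, ∀ j ∈ J, α j = 0 := by
    intro α hα j hj
    rw [← hvfix] at hα
    obtain ⟨β, -, rfl⟩ := MvPolynomial.exists_of_mem_support_freeze hα
    exact Finsupp.filter_apply_neg _ _ (by simpa using hj)
  by_contra hne
  have hv0 : v ≠ 0 := by
    rintro rfl
    exact hne (by simpa using hv)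
  have hdeg : v.totalDegree + 2 * Jᶜ.card ≤ r := by
    obtain ⟨α, hα, hαdeg⟩ := Finset.exists_mem_eq_sup v.support
      (MvPolynomial.support_nonempty.2 hv0) (fun s => s.sum fun _ e => e)
    have hαv : α.degree = v.totalDegree := hαdeg.symm
    have hmem : α + ∑ j ∈ Jᶜ, Finsupp.single j 2 ∈ (MvPolynomial.freeze J c u).support := by
      rw [MvPolynomial.mem_support_iff, hv, MvPolynomial.coeff_prod_one_sub_X_sq_mul hαv]
      exact mul_ne_zero (pow_ne_zero _ (by norm_num)) (MvPolynomial.mem_support_iff.1 hα)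
    rw [← hαv, ← slDeg_add_sum_single_two fun j hj => hvJ α hα j (by simpa using hj)]
    obtain ⟨β, hβ, hβeq⟩ := MvPolynomial.exists_of_mem_support_freeze hmem
    rw [hβeq]
    exact (slDeg_filter_le β _).trans (hu β hβ)
  have hcard : (J.card : ℤ) + Jᶜ.card = n := by
    exact_mod_cast (Finset.card_add_card_compl J).trans (Fintype.card_fin n)
  refine hv0 (MvPolynomial.eq_zero_of_setIntegral_prod_one_sub_sq_eq_zero hvfix ?_)
  rw [← hmom J c hc v hvJ (by omega), ← hv]
  congr 1
  ext y
  rw [map_mul, map_mul, MvPolynomial.eval_freeze]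
  congr 3
  ext i
  by_cases hi : i ∈ J <;> simp [hi]
end

section
/- For every nonzero real polynomial p in n variables, the superlinear degree of the product (1−x_1²)(1−x_2²)···(1−x_n²)·p equals 2n plus the total degree of p: deg₂((1−x_1²)···(1−x_n²)·p) = 2n + deg p. In particular, if (1−x_1²)···(1−x_n²)·p has superlinear degree at most r, then deg p ≤ r − 2n. -/
/-- The superlinear degree of a polynomial: the maximum superlinear degree of its
monomials (zero for the zero polynomial). -/
def slDegPoly {n : ℕ} (p : MvPolynomial (Fin n) ℝ) : ℕ :=
  p.support.sup slDeg

open MvPolynomial in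
lemma totalDegree_prod_one_sub_X_sq_mul_le {σ R : Type*} [CommRing R] (s : Finset σ)
    (p : MvPolynomial σ R) :
    ((∏ i ∈ s, (1 - X i ^ 2)) * p).totalDegree ≤ 2 * s.card + p.totalDegree := by
  have hfactor (i : σ) : (1 - X i ^ 2 : MvPolynomial σ R).totalDegree ≤ 2 := by
    rw [X_pow_eq_monomial]
    refine (totalDegree_sub _ _).trans (max_le (by simp) ?_)
    simpa using totalDegree_monomial_le (Finsupp.single i 2) (1 : R)
  refine (totalDegree_mul _ _).trans (Nat.add_le_add_right ?_ _)
  refine (totalDegree_finsetProd _ _).trans ((Finset.sum_le_sum fun i _ => hfactor i).trans ?_)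
  simp [mul_comm]

open MvPolynomial in
/-- The coefficients of `(∏ i ∈ s, (1 - X i ^ 2)) * p` in top degree. -/
lemma coeff_add_prod_one_sub_X_sq_mul {σ R : Type*} [CommRing R] (s : Finset σ)
    (p : MvPolynomial σ R) (α : σ →₀ ℕ) (hα : α.degree = p.totalDegree) :
    coeff (α + ∑ i ∈ s, Finsupp.single i 2) ((∏ i ∈ s, (1 - X i ^ 2)) * p) =
      (-1) ^ s.card * coeff α p := by
  classical
  induction s using Finset.induction_on with
  | empty => simp
  | insert a s ha ih =>
    have hdeg : ((∏ i ∈ s, (1 - X i ^ 2)) * p).totalDegree <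
        (α + ∑ i ∈ s, Finsupp.single i 2 + Finsupp.single a 2).degree := by
      refine (totalDegree_prod_one_sub_X_sq_mul_le s p).trans_lt ?_
      simp only [map_add, map_sum, Finsupp.degree_single, Finset.sum_const, smul_eq_mul, hα]
      omega
    have hzero := coeff_eq_zero_of_totalDegree_lt hdeg
    rw [Finset.prod_insert ha, Finset.sum_insert ha, Finset.card_insert_of_notMem ha,
      add_comm (Finsupp.single a 2), ← add_assoc, mul_assoc, sub_mul, one_mul, coeff_sub, hzero,
      X_pow_eq_monomial, add_comm _ (Finsupp.single a 2), coeff_monomial_mul, ih]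
    ring

lemma slDeg_le_degree {σ : Type*} [Fintype σ] (α : σ →₀ ℕ) : slDeg α ≤ α.degree := by
  rw [Finsupp.degree_eq_sum]
  exact Finset.sum_le_sum fun i _ => by split_ifs <;> omega

lemma slDeg_eq_degree {σ : Type*} [Fintype σ] {α : σ →₀ ℕ} (h : ∀ i, 2 ≤ α i) :
    slDeg α = α.degree := by
  simp [slDeg, Finsupp.degree_eq_sum, h]

lemma slDegPoly_le_totalDegree {n : ℕ} (p : MvPolynomial (Fin n) ℝ) :
    slDegPoly p ≤ p.totalDegree :=
  Finset.sup_le fun α hα => (slDeg_le_degree α).trans (MvPolynomial.le_totalDegree hα)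

/-- For nonzero `p`, `deg₂((1-x₁²)···(1-xₙ²)·p) = 2n + deg p`; in particular if the
product has superlinear degree at most `r` then `deg p ≤ r - 2n`. -/
theorem slDeg_bubble_mul (n : ℕ) (p : MvPolynomial (Fin n) ℝ) (hp : p ≠ 0) :
    slDegPoly ((∏ i, (1 - MvPolynomial.X i ^ 2)) * p) = 2 * n + p.totalDegree ∧
    ∀ r : ℕ, slDegPoly ((∏ i, (1 - MvPolynomial.X i ^ 2)) * p) ≤ r →
      (p.totalDegree : ℤ) ≤ (r : ℤ) - 2 * n := by
  have heq : slDegPoly ((∏ i, (1 - MvPolynomial.X i ^ 2)) * p) = 2 * n + p.totalDegree := by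
    apply le_antisymm
    · refine (slDegPoly_le_totalDegree _).trans ?_
      simpa using totalDegree_prod_one_sub_X_sq_mul_le Finset.univ p
    · obtain ⟨α, hα, hdeg⟩ := p.support.exists_mem_eq_sup
        (MvPolynomial.support_nonempty.mpr hp) Finsupp.degree
      have hαdeg : α.degree = p.totalDegree := hdeg.symm
      set β : Fin n →₀ ℕ := α + ∑ i, Finsupp.single i 2 with hβ
      have hmem : β ∈ ((∏ i, (1 - MvPolynomial.X i ^ 2)) * p).support := by
        rw [MvPolynomial.mem_support_iff, coeff_add_prod_one_sub_X_sq_mul _ p α hαdeg]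
        exact mul_ne_zero (by simp) (MvPolynomial.mem_support_iff.mp hα)
      have hβi (i : Fin n) : 2 ≤ β i := by
        simp [hβ, Finsupp.single_apply]
      have hβdeg : slDeg β = 2 * n + p.totalDegree := by
        rw [slDeg_eq_degree hβi, hβ]
        simp [hαdeg, add_comm, mul_comm]
      exact hβdeg ▸ Finset.le_sup (f := slDeg) hmem
  exact ⟨heq, fun r hr => by omega⟩
end

section
/- (Trace preserves superlinear degree.) Let u be a real polynomial in n variables with superlinear degree at most r, let i ∈ {1,…,n}, and let c ∈ {−1,1}. Then the polynomial in n − 1 variables obtained from u by substituting x_i = c has superlinear degree at most r. Consequently, the restriction of an element of S_r(n) to any face of the cube [−1,1]^n, expressed as a polynomial in the free variables of that face, lies in the serendipity space of the same degree r on that face. -/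
/-- Forgetting some of the variables does not increase the superlinear degree. -/
theorem slDeg_subtypeDomain_le {σ : Type*} [Fintype σ] (p : σ → Prop) [Fintype {j // p j}]
    (α : σ →₀ ℕ) : slDeg (α.subtypeDomain p) ≤ slDeg α := by
  classical
  unfold slDeg
  simp only [Finsupp.subtypeDomain_apply]
  rw [← Fintype.sum_subtype_add_sum_subtype p (fun j => if 2 ≤ α j then α j else 0)]
  convert Nat.le_add_right _ _
  rfl

/-- Substituting a constant for the variable `i` in a monomial gives a monomial. -/
theorem aeval_dite_C_X_monomial {σ R : Type*} [Fintype σ] [DecidableEq σ] [CommSemiring R]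
    (i : σ) (c a : R) (α : σ →₀ ℕ) :
    MvPolynomial.aeval (fun j : σ =>
        if h : j = i then (MvPolynomial.C c : MvPolynomial {j : σ // j ≠ i} R)
        else MvPolynomial.X ⟨j, h⟩) (MvPolynomial.monomial α a) =
      MvPolynomial.monomial (α.subtypeDomain (· ≠ i)) (a * c ^ α i) := by
  rw [MvPolynomial.aeval_monomial, Finsupp.prod_fintype _ _ (fun _ => pow_zero _),
    Fintype.prod_eq_mul_prod_subtype_ne _ i, MvPolynomial.monomial_eq,
    Finsupp.prod_fintype _ _ (fun _ => pow_zero _), ← mul_assoc, MvPolynomial.algebraMap_eq,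
    dif_pos rfl, map_mul, map_pow]
  congr 1
  exact Finset.prod_congr rfl fun j _ => by rw [dif_neg j.2, Finsupp.subtypeDomain_apply]

/-- Trace preserves superlinear degree: if `u` has superlinear degree at most `r`,
then substituting `x i = c` (with `c = ±1`) yields a polynomial in the remaining
`n - 1` variables of superlinear degree at most `r`. -/
theorem trace_slDeg_le (n r : ℕ) (u : MvPolynomial (Fin n) ℝ)
    (hu : ∀ α ∈ u.support, slDeg α ≤ r) (i : Fin n) (c : ℝ) (hc : c = 1 ∨ c = -1) :
    ∀ β ∈ (MvPolynomial.aeval (fun j : Fin n =>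
        if h : j = i then (MvPolynomial.C c : MvPolynomial {j : Fin n // j ≠ i} ℝ)
        else MvPolynomial.X ⟨j, h⟩) u).support,
      slDeg β ≤ r := by
  intro β hβ
  rw [u.as_sum, map_sum] at hβ
  obtain ⟨α, hα, hαβ⟩ := Finset.mem_biUnion.mp (MvPolynomial.support_sum hβ)
  rw [aeval_dite_C_X_monomial] at hαβ
  rw [Finset.mem_singleton.mp (MvPolynomial.support_monomial_subset hαβ)]
  exact (slDeg_subtypeDomain_le _ α).trans (hu α hα)
end

section
/- (Bubble functions lie in the serendipity space.) Let n ≥ 1, r ≥ 1, let J ⊆ {1,…,n} and c_j ∈ {−1,1} for j ∈ J, let d = n − #J, and set b = Π_{j∉J}(1−x_j²) · Π_{j∈J}(1+c_j x_j). Then for every real polynomial p in the variables x_j, j ∉ J, of total degree at most r − 2d, the product p·b has superlinear degree at most r; i.e., the space V_f = P^f_{r−2d}·b_f is a subspace of S_r(n). -/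
namespace MvPolynomial

variable {σ R : Type*} [CommRing R]

theorem degreeOf_one_add_C_mul_X_le [Nontrivial R] [DecidableEq σ] (i j : σ) (a : R) :
    degreeOf i (1 + C a * X j : MvPolynomial σ R) ≤ if i = j then 1 else 0 := by
  refine (degreeOf_add_le _ _ _).trans (max_le (by simp) ?_)
  exact (degreeOf_C_mul_le _ _ _).trans (degreeOf_X i j).le

theorem degreeOf_prod_one_add_C_mul_X_le [Nontrivial R] [DecidableEq σ] (i : σ) (s : Finset σ)
    (c : σ → R) :
    degreeOf i (∏ j ∈ s, (1 + C (c j) * X j) : MvPolynomial σ R) ≤ if i ∈ s then 1 else 0 :=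
  calc
    _ ≤ ∑ j ∈ s, degreeOf i (1 + C (c j) * X j : MvPolynomial σ R) := degreeOf_prod_le _ _ _
    _ ≤ ∑ j ∈ s, if i = j then 1 else 0 :=
      Finset.sum_le_sum fun j _ => degreeOf_one_add_C_mul_X_le i j (c j)
    _ = if i ∈ s then 1 else 0 := by simp

theorem degreeOf_prod_one_sub_X_sq_of_notMem {i : σ} {s : Finset σ} (hi : i ∉ s) :
    degreeOf i (∏ j ∈ s, (1 - X j ^ 2) : MvPolynomial σ R) = 0 := by
  refine Nat.le_zero.mp ((degreeOf_prod_le _ _ _).trans_eq (Finset.sum_eq_zero fun j hj => ?_))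
  refine Nat.le_zero.mp ((degreeOf_sub_le _ _ _).trans (max_le (by simp) ?_))
  exact (degreeOf_X_pow_of_ne 2 (ne_of_mem_of_not_mem hj hi).symm).le

theorem totalDegree_prod_one_sub_X_sq_le [Nontrivial R] (s : Finset σ) :
    totalDegree (∏ j ∈ s, (1 - X j ^ 2) : MvPolynomial σ R) ≤ 2 * s.card := by
  refine (totalDegree_finsetProd _ _).trans ?_
  rw [mul_comm, ← smul_eq_mul]
  refine Finset.sum_le_card_nsmul _ _ _ fun j _ => (totalDegree_sub _ _).trans ?_
  simp

end MvPolynomial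

/-- Adding to `β` an exponent vector with entries at most `1`, supported where `β` vanishes,
yields superlinear degree at most the degree of `β`. -/
theorem slDeg_add_le_degree {σ : Type*} [Fintype σ] {β γ : σ →₀ ℕ} (hγ : ∀ i, γ i ≤ 1)
    (h : ∀ i, β i = 0 ∨ γ i = 0) : slDeg (β + γ) ≤ β.degree := by
  rw [slDeg, Finsupp.degree_eq_sum]
  refine Finset.sum_le_sum fun i _ => ?_
  have := hγ i
  rw [Finsupp.add_apply]
  split_ifs <;> rcases h i with h | h <;> omega

/-- Bubble functions lie in the serendipity space: for a face of `[-1,1]^n` given by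
frozen indices `J` and signs `c j = ±1` (`j ∈ J`), of dimension `d = n - #J`, with
bubble function `b = Π_{j∉J}(1-x_j²)·Π_{j∈J}(1+c_j x_j)`, and any polynomial `p` in
the variables `x_j, j ∉ J` of total degree at most `r - 2d`, the product `p·b` has
superlinear degree at most `r`. -/
theorem bubble_mul_mem_serendipity (n r : ℕ) (hn : 1 ≤ n) (hr : 1 ≤ r)
    (J : Finset (Fin n)) (c : Fin n → ℝ) (hc : ∀ j ∈ J, c j = 1 ∨ c j = -1)
    (p : MvPolynomial (Fin n) ℝ)
    (hvars : ∀ α ∈ p.support, ∀ j ∈ J, α j = 0)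
    (hdeg : (p.totalDegree : ℤ) ≤ (r : ℤ) - 2 * ((n : ℤ) - J.card)) :
    ∀ α ∈ (p * ((∏ j ∈ Jᶜ, (1 - MvPolynomial.X j ^ 2)) *
        ∏ j ∈ J, (1 + MvPolynomial.C (c j) * MvPolynomial.X j))).support,
      slDeg α ≤ r := by
  classical
  intro α hα
  rw [← mul_assoc] at hα
  obtain ⟨β, hβ, γ, hγ, rfl⟩ := Finset.mem_add.mp (MvPolynomial.support_mul _ _ hα)
  have hγJ i : γ i ≤ if i ∈ J then 1 else 0 :=
    (MvPolynomial.monomial_le_degreeOf i hγ).trans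
      (MvPolynomial.degreeOf_prod_one_add_C_mul_X_le i J c)
  have hβJ i (hi : i ∈ J) : β i = 0 := by
    have hp : p.degreeOf i = 0 := by
      rw [MvPolynomial.degreeOf_eq_sup]
      exact Nat.le_zero.mp (Finset.sup_le fun α hα => (hvars α hα i hi).le)
    have := (MvPolynomial.monomial_le_degreeOf i hβ).trans (MvPolynomial.degreeOf_mul_le i _ _)
    rwa [hp, MvPolynomial.degreeOf_prod_one_sub_X_sq_of_notMem (by simpa using hi),
      Nat.le_zero] at this
  refine (slDeg_add_le_degree (fun i => (hγJ i).trans (by split_ifs <;> simp)) fun i => ?_).trans ?_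
  · by_cases hi : i ∈ J
    · exact .inl (hβJ i hi)
    · exact .inr (by simpa [hi] using hγJ i)
  · have h₁ : β.degree ≤ _ := MvPolynomial.le_totalDegree hβ
    have h₂ := MvPolynomial.totalDegree_mul p (∏ j ∈ Jᶜ, (1 - MvPolynomial.X j ^ 2))
    have h₃ := MvPolynomial.totalDegree_prod_one_sub_X_sq_le (R := ℝ) Jᶜ
    have h₄ := Finset.card_add_card_compl J
    rw [Fintype.card_fin] at h₄
    omega
end

section
/- (Geometric decomposition: spanning, Theorem 3.1.) Let n ≥ 1 and r ≥ 1. For each face f of the cube [−1,1]^n of dimension d, specified by J ⊆ {1,…,n} with #J = n − d and signs c_j ∈ {−1,1} (j ∈ J), let V_f = { p · Π_{j∉J}(1−x_j²) · Π_{j∈J}(1+c_j x_j) : p a real polynomial of total degree at most r − 2d in the variables x_j, j ∉ J }. Then the serendipity space is the sum over all faces: S_r(n) = Σ_{f ∈ Δ([−1,1]^n)} V_f. -/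
/-- A face of the cube `[-1,1]^n`: a set `J` of frozen coordinate indices together
with a sign (`true` for `+1`, `false` for `-1`) for each frozen coordinate.  The
dimension of the face is `n - #J`. -/
def Face (n : ℕ) : Type :=
  Σ J : Finset (Fin n), ({j : Fin n // j ∈ J} → Bool)

/-- The bubble function `b_f = Π_{j∉J}(1-x_j²) · Π_{j∈J}(1+c_j x_j)` of a face. -/
noncomputable def bubble {n : ℕ} (f : Face n) : MvPolynomial (Fin n) ℝ :=
  (∏ j ∈ f.1ᶜ, (1 - MvPolynomial.X j ^ 2)) *
    ∏ j ∈ f.1.attach, (1 + MvPolynomial.C (if f.2 j then (1 : ℝ) else -1) * MvPolynomial.X j.1)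

/-- Polynomials in the variables `x_j, j ∉ J` of total degree at most `s`
(`s` an integer, so this is `{0}` when `s < 0`). -/
noncomputable def facePoly (n : ℕ) (s : ℤ) (J : Finset (Fin n)) :
    Submodule ℝ (MvPolynomial (Fin n) ℝ) where
  carrier := {p | ∀ α ∈ p.support, (∀ j ∈ J, α j = 0) ∧ ((∑ i, α i : ℕ) : ℤ) ≤ s}
  add_mem' := by
    intro a b ha hb α hα
    rcases Finset.mem_union.mp (MvPolynomial.support_add hα) with h | h
    · exact ha α h
    · exact hb α h
  zero_mem' := by simp
  smul_mem' := by
    intro t p hp α hα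
    exact hp α (MvPolynomial.support_smul hα)

/-- The space `V_f = P^f_{r-2d} · b_f` associated to a face `f` of dimension
`d = n - #J`. -/
noncomputable def faceSpace (n r : ℕ) (f : Face n) : Submodule ℝ (MvPolynomial (Fin n) ℝ) :=
  Submodule.map (LinearMap.mulRight ℝ (bubble f))
    (facePoly n ((r : ℤ) - 2 * ((n : ℤ) - f.1.card)) f.1)

namespace facePoly

variable {n : ℕ} {J : Finset (Fin n)} {s t : ℤ} {p q : MvPolynomial (Fin n) ℝ}

theorem mono (hst : s ≤ t) : facePoly n s J ≤ facePoly n t J :=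
  fun _ hp α hα => ⟨(hp α hα).1, (hp α hα).2.trans hst⟩

theorem C_mem (c : ℝ) : MvPolynomial.C c ∈ facePoly n 0 J := by
  intro α hα
  obtain rfl : α = 0 := by
    simpa using MvPolynomial.support_monomial_subset (s := 0) (a := c) hα
  simp

theorem X_pow_mem {i : Fin n} (hi : i ∉ J) (k : ℕ) :
    (MvPolynomial.X i ^ k : MvPolynomial (Fin n) ℝ) ∈ facePoly n k J := by
  intro α hα
  rw [MvPolynomial.X_pow_eq_monomial] at hα
  obtain rfl : α = Finsupp.single i k := by
    simpa using MvPolynomial.support_monomial_subset hα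
  refine ⟨fun j hj => Finsupp.single_eq_of_ne (by rintro rfl; exact hi hj), ?_⟩
  simp [Finsupp.single_apply]

theorem mul_mem (hp : p ∈ facePoly n s J) (hq : q ∈ facePoly n t J) :
    p * q ∈ facePoly n (s + t) J := by
  classical
  intro α hα
  obtain ⟨β, hβ, γ, hγ, rfl⟩ := Finset.mem_add.mp (MvPolynomial.support_mul p q hα)
  obtain ⟨hβJ, hβs⟩ := hp β hβ
  obtain ⟨hγJ, hγt⟩ := hq γ hγ
  refine ⟨fun j hj => by simp [hβJ j hj, hγJ j hj], ?_⟩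
  simp only [Finsupp.add_apply, Finset.sum_add_distrib]
  push_cast at *
  exact add_le_add hβs hγt

theorem prod_mem {ι : Type*} (S : Finset ι) {f : ι → MvPolynomial (Fin n) ℝ} {d : ι → ℤ}
    (h : ∀ i ∈ S, f i ∈ facePoly n (d i) J) : ∏ i ∈ S, f i ∈ facePoly n (∑ i ∈ S, d i) J := by
  classical
  induction S using Finset.induction_on with
  | empty => simpa using C_mem (J := J) 1
  | insert a S ha ih =>
    rw [Finset.prod_insert ha, Finset.sum_insert ha]
    exact mul_mem (h a (Finset.mem_insert_self a S))
      (ih fun i hi => h i (Finset.mem_insert_of_mem hi))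

end facePoly

/-- A power of one variable is a combination of the two vertex bubbles plus a multiple of the
edge bubble, the cofactor having superlinear degree dropped by two. -/
theorem exists_X_pow_eq_bubbles {n : ℕ} (i : Fin n) (k : ℕ) :
    ∃ (q : MvPolynomial (Fin n) ℝ) (c : Bool → ℝ),
      (∀ J : Finset (Fin n), i ∉ J →
        q ∈ facePoly n (((if 2 ≤ k then k else 0 : ℕ) : ℤ) - 2) J) ∧
      (MvPolynomial.X i ^ k : MvPolynomial (Fin n) ℝ) =
        q * (1 - MvPolynomial.X i ^ 2) + ∑ b, MvPolynomial.C (c b) *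
          (1 + MvPolynomial.C (if b then (1 : ℝ) else -1) * MvPolynomial.X i) := by
  have half : (MvPolynomial.C (1 / 2) : MvPolynomial (Fin n) ℝ) * 2 = 1 := by
    rw [← map_ofNat (MvPolynomial.C : ℝ →+* MvPolynomial (Fin n) ℝ) 2, ← map_mul]
    norm_num
  induction k using Nat.twoStepInduction with
  | zero =>
    refine ⟨0, fun _ => 1 / 2, fun _ _ => zero_mem _, ?_⟩
    simp only [Fintype.sum_bool, if_true, Bool.false_eq_true, if_false, map_neg, map_one]
    linear_combination -half
  | one =>
    refine ⟨0, fun b => if b then 1 / 2 else -(1 / 2), fun _ _ => zero_mem _, ?_⟩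
    simp only [Fintype.sum_bool, if_true, Bool.false_eq_true, if_false, map_neg, map_one]
    linear_combination -MvPolynomial.X i * half
  | more k ih _ =>
    obtain ⟨q, c, hq, h⟩ := ih
    refine ⟨q - MvPolynomial.X i ^ k, c, fun J hi => ?_, by linear_combination h⟩
    refine sub_mem (facePoly.mono ?_ (hq J hi)) (facePoly.mono ?_ (facePoly.X_pow_mem hi k))
    · split_ifs <;> omega
    · split_ifs <;> omega

theorem degreeOf_bubble_le {n : ℕ} (f : Face n) (i : Fin n) :
    (bubble f).degreeOf i ≤ if i ∈ f.1 then 1 else 2 := by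
  have hint (j : Fin n) : (1 - MvPolynomial.X j ^ 2 : MvPolynomial (Fin n) ℝ).degreeOf i ≤
      if i = j then 2 else 0 := by
    refine (MvPolynomial.degreeOf_sub_le i _ _).trans ?_
    rw [MvPolynomial.degreeOf_one, Nat.zero_max]
    refine (MvPolynomial.degreeOf_pow_le i _ 2).trans ?_
    rw [MvPolynomial.degreeOf_X]
    split_ifs <;> simp
  have hvert (c : ℝ) (j : Fin n) :
      (1 + MvPolynomial.C c * MvPolynomial.X j : MvPolynomial (Fin n) ℝ).degreeOf i ≤
        if i = j then 1 else 0 := by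
    refine (MvPolynomial.degreeOf_add_le i _ _).trans ?_
    rw [MvPolynomial.degreeOf_one, Nat.zero_max]
    refine (MvPolynomial.degreeOf_C_mul_le _ i c).trans ?_
    rw [MvPolynomial.degreeOf_X]
  calc (bubble f).degreeOf i
      ≤ (∑ j ∈ f.1ᶜ, if i = j then 2 else 0) + ∑ j ∈ f.1.attach, if i = j.1 then 1 else 0 :=
        (MvPolynomial.degreeOf_mul_le i _ _).trans <| add_le_add
          ((MvPolynomial.degreeOf_prod_le i _ _).trans (Finset.sum_le_sum fun j _ => hint j))
          ((MvPolynomial.degreeOf_prod_le i _ _).trans (Finset.sum_le_sum fun j _ => hvert _ j))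
    _ ≤ if i ∈ f.1 then 1 else 2 := by
        rw [Finset.sum_attach f.1 fun j => if i = j then 1 else 0]
        by_cases hi : i ∈ f.1 <;> simp [hi]

theorem faceSpace_le_serendipity (n r : ℕ) (f : Face n) : faceSpace n r f ≤ serendipity n r := by
  classical
  rintro _ ⟨p, hp, rfl⟩ α hα
  rw [LinearMap.mulRight_apply] at hα
  obtain ⟨β, hβ, γ, hγ, rfl⟩ := Finset.mem_add.mp (MvPolynomial.support_mul _ _ hα)
  obtain ⟨hβJ, hβs⟩ := hp β hβ
  have hγle (i : Fin n) : γ i ≤ if i ∈ f.1 then 1 else 2 :=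
    (MvPolynomial.monomial_le_degreeOf i hγ).trans (degreeOf_bubble_le f i)
  have hle : slDeg (β + γ) ≤ ∑ i, (β i + if i ∈ f.1ᶜ then 2 else 0) := by
    refine Finset.sum_le_sum fun i _ => ?_
    have := hγle i
    have hβ0 := hβJ i
    change (if 2 ≤ β i + γ i then β i + γ i else 0) ≤ _
    simp only [Finset.mem_compl]
    by_cases hi : i ∈ f.1
    · simp only [hi, if_true, not_true_eq_false, if_false, forall_const] at *
      split_ifs <;> omega
    · simp only [hi, if_false, not_false_eq_true, if_true] at *
      split_ifs <;> omega
  have hcard : (f.1ᶜ).card + f.1.card = n := by simp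
  rw [Finset.sum_add_distrib, Finset.sum_ite_mem, Finset.univ_inter, Finset.sum_const,
    smul_eq_mul] at hle
  omega

/-- The face whose free coordinates are those sent to `none`. -/
def Face.ofSigns {n : ℕ} (x : Fin n → Option Bool) : Face n :=
  ⟨Finset.univ.filter fun i => (x i).isSome, fun j => (x j.1).getD true⟩

theorem monomial_mem_iSup_faceSpace {n r : ℕ} {α : Fin n →₀ ℕ} (hα : slDeg α ≤ r) :
    (MvPolynomial.monomial α (1 : ℝ)) ∈ ⨆ f : Face n, faceSpace n r f := by
  classical
  choose q c hq hX using fun i => exists_X_pow_eq_bubbles i (α i)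
  let cof (i : Fin n) (o : Option Bool) : MvPolynomial (Fin n) ℝ :=
    o.elim (q i) fun b => MvPolynomial.C (c i b)
  let bub (i : Fin n) (o : Option Bool) : MvPolynomial (Fin n) ℝ :=
    o.elim (1 - MvPolynomial.X i ^ 2)
      fun b => 1 + MvPolynomial.C (if b then (1 : ℝ) else -1) * MvPolynomial.X i
  have hmon : MvPolynomial.monomial α (1 : ℝ) =
      ∑ x : Fin n → Option Bool, (∏ i, cof i (x i)) * ∏ i, bub i (x i) := by
    rw [MvPolynomial.monomial_eq, map_one, one_mul,
      Finsupp.prod_fintype _ _ fun i => pow_zero _]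
    simp_rw [← Finset.prod_mul_distrib]
    rw [← Fintype.prod_sum fun i o => cof i o * bub i o]
    refine Finset.prod_congr rfl fun i _ => ?_
    rw [Fintype.sum_option]
    exact hX i
  rw [hmon]
  refine sum_mem fun x _ => Submodule.mem_iSup_of_mem (Face.ofSigns x) ?_
  set J := (Face.ofSigns x).1 with hJ
  have hmem (i : Fin n) : i ∈ J ↔ (x i).isSome := by simp [hJ, Face.ofSigns]
  have hbub : bubble (Face.ofSigns x) = ∏ i, bub i (x i) := by
    rw [← Finset.prod_compl_mul_prod J, bubble]
    congr 1
    · refine Finset.prod_congr rfl fun i hi => ?_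
      have hi' : x i = none := by simpa [hmem] using hi
      simp [bub, hi']
    · rw [← Finset.prod_attach J]
      refine Finset.prod_congr rfl fun i _ => ?_
      obtain ⟨b, hb⟩ := Option.isSome_iff_exists.mp ((hmem i.1).mp i.2)
      simp [bub, hb, Face.ofSigns]
  refine ⟨∏ i, cof i (x i), ?_, by rw [LinearMap.mulRight_apply, hbub]⟩
  have hcof := facePoly.prod_mem (J := J) Finset.univ (f := fun i => cof i (x i))
    (d := fun i => if i ∈ Jᶜ then ((if 2 ≤ α i then α i else 0 : ℕ) : ℤ) - 2 else 0) fun i _ => by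
      by_cases hi : i ∈ J
      · obtain ⟨b, hb⟩ := Option.isSome_iff_exists.mp ((hmem i).mp hi)
        simpa [cof, hb, hi] using facePoly.C_mem (J := J) (c i b)
      · have hi' : x i = none := by simpa [hmem] using hi
        have := hq i J hi
        simp only [Finset.mem_compl, hi, not_false_eq_true, if_true, cof, hi']
        exact this
  refine facePoly.mono ?_ hcof
  have hcard : (Jᶜ).card + J.card = n := by simp
  have hsub : ∑ i ∈ Jᶜ, (if 2 ≤ α i then α i else 0) ≤ slDeg α :=
    Finset.sum_le_sum_of_subset (Finset.subset_univ _)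
  rw [Finset.sum_ite_mem, Finset.univ_inter, Finset.sum_sub_distrib, Finset.sum_const,
    nsmul_eq_mul, ← Nat.cast_sum, ← hJ]
  omega

/-- Geometric decomposition of the serendipity space (Theorem 3.1, spanning):
`S_r(n) = Σ_{f ∈ Δ([-1,1]^n)} V_f`. -/
theorem serendipity_eq_sum_faceSpaces (n r : ℕ) (hn : 1 ≤ n) (hr : 1 ≤ r) :
    serendipity n r = ⨆ f : Face n, faceSpace n r f := by
  refine le_antisymm (fun p hp => ?_) (iSup_le (faceSpace_le_serendipity n r))
  rw [p.as_sum]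
  refine sum_mem fun α hα => ?_
  rw [← mul_one (p.coeff α), ← smul_eq_mul, ← MvPolynomial.smul_monomial]
  exact Submodule.smul_mem _ _ (monomial_mem_iSup_faceSpace (hp α hα))
end

section
/- (Geometric decomposition: directness, Theorem 3.1.) Let n ≥ 1 and r ≥ 1. For each face f of the cube [−1,1]^n of dimension d, specified by J ⊆ {1,…,n} with #J = n − d and signs c_j ∈ {−1,1} (j ∈ J), let V_f = { p · Π_{j∉J}(1−x_j²) · Π_{j∈J}(1+c_j x_j) : p a real polynomial of total degree at most r − 2d in the variables x_j, j ∉ J }. Then the family of subspaces (V_f), indexed by all faces f of [−1,1]^n, is independent: the sum Σ_f V_f is a direct sum, i.e., if a finite family (v_f) with v_f ∈ V_f satisfies Σ_f v_f = 0, then v_f = 0 for every f. -/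
instance (n : ℕ) : Fintype (Face n) := by unfold Face; infer_instance

/-- Restriction to the affine hull of a face: freeze `x_j = c_j` for `j ∈ J`. -/
noncomputable def restrictFace {n : ℕ} (f : Face n) :
    MvPolynomial (Fin n) ℝ →ₐ[ℝ] MvPolynomial (Fin n) ℝ :=
  MvPolynomial.aeval fun i =>
    if h : i ∈ f.1 then MvPolynomial.C (if f.2 ⟨i, h⟩ then (1 : ℝ) else -1) else MvPolynomial.X i

theorem restrictFace_X_of_mem {n : ℕ} (f : Face n) {i : Fin n} (h : i ∈ f.1) :
    restrictFace f (MvPolynomial.X i) = MvPolynomial.C (if f.2 ⟨i, h⟩ then (1 : ℝ) else -1) := by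
  simp only [restrictFace, MvPolynomial.aeval_X, dif_pos h]

theorem restrictFace_X_of_notMem {n : ℕ} (f : Face n) {i : Fin n} (h : i ∉ f.1) :
    restrictFace f (MvPolynomial.X i) = MvPolynomial.X i := by
  simp only [restrictFace, MvPolynomial.aeval_X, dif_neg h]

theorem restrictFace_C {n : ℕ} (f : Face n) (a : ℝ) :
    restrictFace f (MvPolynomial.C a) = MvPolynomial.C a :=
  (restrictFace f).commutes a

/-- Polynomials in the free variables of a face are fixed by restriction to it. -/
theorem restrictFace_eq_self {n : ℕ} {s : ℤ} (f : Face n) {p : MvPolynomial (Fin n) ℝ}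
    (hp : p ∈ facePoly n s f.1) : restrictFace f p = p := by
  conv_rhs => rw [← AlgHom.id_apply (R := ℝ) p, ← MvPolynomial.aeval_X_left]
  refine MvPolynomial.eval₂Hom_congr' rfl (fun i hi _ => ?_) rfl
  obtain ⟨α, hα, hiα⟩ := (MvPolynomial.mem_vars_iff_mem_support i).mp hi
  exact dif_neg fun h => Finsupp.mem_support_iff.mp hiα ((hp α hα).1 i h)

theorem restrictFace_bubble_self_ne_zero {n : ℕ} (f : Face n) :
    restrictFace f (bubble f) ≠ 0 := by
  rw [bubble, map_mul, map_prod, map_prod]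
  refine mul_ne_zero (Finset.prod_ne_zero_iff.mpr fun j hj h => ?_)
    (Finset.prod_ne_zero_iff.mpr fun j _ h => ?_)
  · rw [map_sub, map_one, map_pow, restrictFace_X_of_notMem f (Finset.mem_compl.mp hj)] at h
    simpa using congrArg (MvPolynomial.eval (0 : Fin n → ℝ)) h
  · rw [map_add, map_one, map_mul, restrictFace_C, restrictFace_X_of_mem f j.2] at h
    have := congrArg (MvPolynomial.eval (0 : Fin n → ℝ)) h
    cases hc : f.2 j <;> simp [hc] at this

/-- If the bubble function of `g` does not vanish on `f`, then `g` is `f` itself or a face of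
smaller dimension. -/
theorem eq_or_ssubset_of_restrictFace_bubble_ne_zero {n : ℕ} {f g : Face n}
    (h : restrictFace f (bubble g) ≠ 0) : g = f ∨ f.1 ⊂ g.1 := by
  rw [bubble, map_mul, map_prod, map_prod] at h
  have hfree := Finset.prod_ne_zero_iff.mp (left_ne_zero_of_mul h)
  have hfrozen := Finset.prod_ne_zero_iff.mp (right_ne_zero_of_mul h)
  have hsub : f.1 ⊆ g.1 := by
    intro j hj
    by_contra hjg
    refine hfree j (Finset.mem_compl.mpr hjg) ?_
    rw [map_sub, map_one, map_pow, restrictFace_X_of_mem f hj]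
    split_ifs <;> simp
  have hsign : ∀ j (hjf : j ∈ f.1) (hjg : j ∈ g.1), g.2 ⟨j, hjg⟩ = f.2 ⟨j, hjf⟩ := by
    intro j hjf hjg
    by_contra hne
    refine hfrozen ⟨j, hjg⟩ (Finset.mem_attach _ _) ?_
    rw [map_add, map_one, map_mul, restrictFace_C, restrictFace_X_of_mem f hjf]
    cases hc : f.2 ⟨j, hjf⟩ <;> cases he : g.2 ⟨j, hjg⟩ <;> simp_all
  rcases hsub.eq_or_ssubset with heq | hss
  · left
    obtain ⟨J, c⟩ := f
    obtain ⟨K, e⟩ := g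
    obtain rfl : J = K := heq
    obtain rfl : e = c := funext fun j => hsign j j.2 j.2
    rfl
  · exact Or.inr hss

/-- Geometric decomposition of the serendipity space (Theorem 3.1, directness):
the family of subspaces `(V_f)` indexed by the faces of `[-1,1]^n` is independent:
if `v_f ∈ V_f` for every face `f` and `Σ_f v_f = 0`, then every `v_f = 0`. -/
theorem faceSpaces_independent (n r : ℕ) (hn : 1 ≤ n) (hr : 1 ≤ r)
    (v : Face n → MvPolynomial (Fin n) ℝ) (hv : ∀ f, v f ∈ faceSpace n r f)
    (hsum : ∑ f, v f = 0) : ∀ f, v f = 0 := by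
  suffices H : ∀ (d : ℕ) (f : Face n), n - f.1.card = d → v f = 0 from fun f => H _ f rfl
  intro d
  induction d using Nat.strong_induction_on with
  | _ d ih =>
    rintro f rfl
    have hother : ∀ g, g ≠ f → restrictFace f (v g) = 0 := by
      intro g hg
      by_cases hb : restrictFace f (bubble g) = 0
      · obtain ⟨p, -, hp⟩ := hv g
        rw [← hp, LinearMap.mulRight_apply, map_mul, hb, mul_zero]
      · have hss := (eq_or_ssubset_of_restrictFace_bubble_ne_zero hb).resolve_left hg
        have hlt := Finset.card_lt_card hss
        have hle := Finset.card_le_univ g.1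
        rw [Fintype.card_fin] at hle
        rw [ih (n - g.1.card) (by omega) g rfl, map_zero]
    have hself : restrictFace f (v f) = 0 := by
      rw [← Fintype.sum_eq_single f hother, ← map_sum, hsum, map_zero]
    obtain ⟨p, hp, hpv⟩ := hv f
    rw [← hpv, LinearMap.mulRight_apply, map_mul, restrictFace_eq_self f hp] at hself
    rw [← hpv, (mul_eq_zero.mp hself).resolve_right (restrictFace_bubble_self_ne_zero f), map_zero]
end

section
/- (Key spanning step in the proof of Theorem 3.1.) Let n ≥ 1, r ≥ 1, and let x^α be a monomial in n variables with superlinear degree Σ_{i : α_i ≥ 2} α_i ≤ r. Then x^α lies in the sum Σ_f V_f over all faces f of [−1,1]^n, where for a face f of dimension d specified by (J, c), V_f is the set of products p · Π_{j∉J}(1−x_j²) · Π_{j∈J}(1+c_j x_j) with p a polynomial of total degree at most r − 2d in the variables x_j, j ∉ J. -/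
theorem facePoly_mono {n : ℕ} {s t : ℤ} (h : s ≤ t) (J : Finset (Fin n)) :
    facePoly n s J ≤ facePoly n t J :=
  fun _ hp α hα => ⟨(hp α hα).1, (hp α hα).2.trans h⟩

theorem mul_mem_facePoly {n : ℕ} {s t : ℤ} {J : Finset (Fin n)}
    {p q : MvPolynomial (Fin n) ℝ} (hp : p ∈ facePoly n s J) (hq : q ∈ facePoly n t J) :
    p * q ∈ facePoly n (s + t) J := by
  intro α hα
  obtain ⟨β, hβ, γ, hγ, rfl⟩ := Finset.mem_add.mp (MvPolynomial.support_mul p q hα)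
  refine ⟨fun j hj => ?_, ?_⟩
  · simp [(hp β hβ).1 j hj, (hq γ hγ).1 j hj]
  · have h₁ := (hp β hβ).2
    have h₂ := (hq γ hγ).2
    simp only [Finsupp.add_apply, Finset.sum_add_distrib]
    push_cast at h₁ h₂ ⊢
    linarith

theorem X_pow_mem_facePoly {n : ℕ} {J : Finset (Fin n)} {i : Fin n} (hi : i ∉ J) (a : ℕ) :
    (MvPolynomial.X i ^ a : MvPolynomial (Fin n) ℝ) ∈ facePoly n a J := by
  intro α hα
  rw [MvPolynomial.X_pow_eq_monomial] at hα
  obtain rfl := Finset.mem_singleton.mp (MvPolynomial.support_monomial_subset hα)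
  refine ⟨fun j hj => Finsupp.single_eq_of_ne (fun h => hi (h ▸ hj)), ?_⟩
  simp [Finsupp.single_apply]

theorem C_mem_facePoly {n : ℕ} (J : Finset (Fin n)) (c : ℝ) :
    (MvPolynomial.C c : MvPolynomial (Fin n) ℝ) ∈ facePoly n 0 J := by
  intro α hα
  obtain rfl := Finset.mem_singleton.mp (MvPolynomial.support_monomial_subset hα)
  simp

theorem prod_mem_facePoly {n : ℕ} {ι : Type*} {J : Finset (Fin n)} (T : Finset ι) (s : ι → ℤ)
    (g : ι → MvPolynomial (Fin n) ℝ) (h : ∀ i ∈ T, g i ∈ facePoly n (s i) J) :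
    ∏ i ∈ T, g i ∈ facePoly n (∑ i ∈ T, s i) J := by
  classical
  induction T using Finset.induction_on with
  | empty => simpa using C_mem_facePoly J 1
  | insert a T ha ih =>
    rw [Finset.prod_insert ha, Finset.sum_insert ha]
    exact mul_mem_facePoly (h a (Finset.mem_insert_self a T))
      (ih fun i hi => h i (Finset.mem_insert_of_mem hi))

/-- The factors of the bubble functions in a single variable: `none` stands for a free
coordinate, `some b` for a coordinate frozen with sign `b`. -/
noncomputable def bubbleFactor {n : ℕ} (i : Fin n) : Option Bool → MvPolynomial (Fin n) ℝ
  | none => 1 - MvPolynomial.X i ^ 2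
  | some b => 1 + MvPolynomial.C (if b then (1 : ℝ) else -1) * MvPolynomial.X i

/-- A power of one variable is a combination of the bubble factors in that variable. -/
theorem exists_X_pow_eq_sum_bubbleFactor {n : ℕ} (i : Fin n) (a : ℕ) :
    ∃ w : Option Bool → MvPolynomial (Fin n) ℝ,
      (∀ b, ∀ J, w (some b) ∈ facePoly n 0 J) ∧
      (∀ J, i ∉ J → w none ∈ facePoly n (((if 2 ≤ a then a else 0 : ℕ) : ℤ) - 2) J) ∧
      (MvPolynomial.X i ^ a : MvPolynomial (Fin n) ℝ) = ∑ k, w k * bubbleFactor i k := by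
  have half : (MvPolynomial.C (1 / 2) : MvPolynomial (Fin n) ℝ) * 2 = 1 := by
    rw [← map_ofNat (MvPolynomial.C (σ := Fin n) (R := ℝ)) 2, ← map_mul]
    norm_num
  induction a using Nat.twoStepInduction with
  | zero =>
    refine ⟨fun k => k.elim 0 fun _ => MvPolynomial.C (1 / 2), fun b J => C_mem_facePoly J _,
      fun J _ => Submodule.zero_mem _, ?_⟩
    simp only [Fintype.sum_option, Fintype.sum_bool, bubbleFactor, Option.elim, if_true,
      Bool.false_eq_true, if_false, map_neg, map_one]
    linear_combination -half
  | one =>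
    refine ⟨fun k => k.elim 0 fun b => MvPolynomial.C (if b then 1 / 2 else -(1 / 2)),
      fun b J => C_mem_facePoly J _, fun J _ => Submodule.zero_mem _, ?_⟩
    simp only [Fintype.sum_option, Fintype.sum_bool, bubbleFactor, Option.elim, if_true,
      Bool.false_eq_true, if_false, map_neg, map_one]
    linear_combination -MvPolynomial.X i * half
  | more a ih _ =>
    obtain ⟨w, hsome, hnone, hw⟩ := ih
    refine ⟨fun k => k.elim (w none - MvPolynomial.X i ^ a) fun b => w (some b), hsome,
      fun J hi => Submodule.sub_mem _ (facePoly_mono ?_ J (hnone J hi))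
        (facePoly_mono ?_ J (X_pow_mem_facePoly hi a)), ?_⟩
    · split_ifs <;> push_cast <;> omega
    · simp
    · simp only [Fintype.sum_option, bubbleFactor, Option.elim] at hw ⊢
      linear_combination hw

/-- The face whose frozen coordinates and signs are recorded by `κ`. -/
def faceOf {n : ℕ} (κ : Fin n → Option Bool) : Face n :=
  ⟨Finset.univ.filter fun i => (κ i).isSome, fun j => (κ j.1).getD true⟩

theorem bubble_faceOf {n : ℕ} (κ : Fin n → Option Bool) :
    bubble (faceOf κ) = ∏ i, bubbleFactor i (κ i) := by
  have hfree : ∏ j ∈ (faceOf κ).1ᶜ, (1 - MvPolynomial.X j ^ 2 : MvPolynomial (Fin n) ℝ) =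
      ∏ j ∈ (faceOf κ).1ᶜ, bubbleFactor j (κ j) := by
    refine Finset.prod_congr rfl fun j hj => ?_
    have : κ j = none := by simpa [faceOf] using hj
    rw [this, bubbleFactor]
  have hfrozen : ∏ j ∈ (faceOf κ).1.attach, (1 + MvPolynomial.C
      (if (faceOf κ).2 j then (1 : ℝ) else -1) * MvPolynomial.X j.1) =
      ∏ j ∈ (faceOf κ).1, bubbleFactor j (κ j) := by
    rw [← Finset.prod_attach (faceOf κ).1]
    refine Finset.prod_congr rfl fun j _ => ?_
    obtain ⟨b, hb⟩ := Option.isSome_iff_exists.mp (Finset.mem_filter.mp j.2).2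
    simp [faceOf, hb, bubbleFactor]
  rw [bubble, hfree, hfrozen, mul_comm, Finset.prod_mul_prod_compl]

/-- Key spanning step in the proof of Theorem 3.1: every monomial `x^α` of
superlinear degree at most `r` lies in the sum `Σ_f V_f` over all faces. -/
theorem monomial_mem_sum_faceSpaces (n r : ℕ) (hn : 1 ≤ n) (hr : 1 ≤ r)
    (α : Fin n →₀ ℕ) (hα : slDeg α ≤ r) :
    MvPolynomial.monomial α (1 : ℝ) ∈ ⨆ f : Face n, faceSpace n r f := by
  choose w hsome hnone hw using fun i => exists_X_pow_eq_sum_bubbleFactor i (α i)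
  have hexp : MvPolynomial.monomial α (1 : ℝ) =
      ∑ κ : Fin n → Option Bool, (∏ i, w i (κ i)) * bubble (faceOf κ) := by
    rw [MvPolynomial.monomial_eq, map_one, one_mul, Finsupp.prod_fintype _ _ (by simp)]
    simp_rw [hw, Fintype.prod_sum, bubble_faceOf, Finset.prod_mul_distrib]
  rw [hexp]
  refine Submodule.sum_mem _ fun κ _ => Submodule.mem_iSup_of_mem (faceOf κ)
    (Submodule.mem_map_of_mem (f := LinearMap.mulRight ℝ (bubble (faceOf κ))) ?_)
  set J := (faceOf κ).1 with hJ
  let s : Fin n → ℤ := fun i =>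
    if i ∈ J then 0 else ((if 2 ≤ α i then α i else 0 : ℕ) : ℤ) - 2
  refine facePoly_mono (s := ∑ i, s i) ?_ J (prod_mem_facePoly _ s _ fun i _ => ?_)
  · have hcard : ((n : ℤ) - J.card) = ∑ i, if i ∈ J then 0 else 1 := by
      have h := Finset.card_add_card_compl J
      rw [Fintype.card_fin] at h
      have hsum : (∑ i, if i ∈ J then (0 : ℤ) else 1) = Jᶜ.card := by
        simp [Finset.sum_ite, Finset.filter_not, Finset.compl_eq_univ_sdiff]
      rw [hsum]
      lia
    have hsl : ((slDeg α : ℕ) : ℤ) ≤ r := by exact_mod_cast hα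
    have hle : ∑ i, s i ≤ ∑ i, (((if 2 ≤ α i then α i else 0 : ℕ) : ℤ) -
        2 * if i ∈ J then 0 else 1) :=
      Finset.sum_le_sum fun i _ => by
        simp only [s]
        split_ifs <;> simp
    rw [Finset.sum_sub_distrib, ← Finset.mul_sum, ← hcard] at hle
    rw [slDeg, Nat.cast_sum] at hsl
    linarith
  · by_cases hi : i ∈ J
    · obtain ⟨b, hb⟩ := Option.isSome_iff_exists.mp (Finset.mem_filter.mp hi).2
      simpa [s, hi, hb] using hsome i b J
    · have hκ : κ i = none := by simpa [hJ, faceOf] using hi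
      simpa only [s, if_neg hi, hκ] using hnone i J hi
end

section
/- (Face-restriction determination, used for continuity of assembled serendipity functions.) Let n ≥ 2, r ≥ 1, let u be a real polynomial in n variables with superlinear degree at most r, and let F be a face of [−1,1]^n of dimension n−1, given by x_i = c for some i ∈ {1,…,n} and c ∈ {−1,1}. Suppose that for every face f of [−1,1]^n contained in F, of dimension d and specified by (J, c'), and for every polynomial q of total degree at most r − 2d in the variables x_j, j ∉ J, the moment ∫_f u·q vanishes (for d = 0 the moment is the value of u at the vertex). Then the restriction of u to F is identically zero, i.e., substituting x_i = c into u yields the zero polynomial. -/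
open MeasureTheory

namespace MvPolynomial

section Restriction

variable {σ : Type*} [DecidableEq σ]

/-- Substitution of `X j = c j` for `j ∈ J`, the other variables being kept. -/
noncomputable def restrictVars (J : Finset σ) (c : σ → ℝ) :
    MvPolynomial σ ℝ →ₐ[ℝ] MvPolynomial σ ℝ :=
  aeval fun j => if j ∈ J then C (c j) else X j

theorem restrictVars_X (J : Finset σ) (c : σ → ℝ) (j : σ) :
    restrictVars J c (X j) = if j ∈ J then C (c j) else X j := by
  simp [restrictVars]

theorem restrictVars_singleton_restrictVars (J : Finset σ) (c : σ → ℝ) {j : σ} (hj : j ∉ J)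
    (s : ℝ) (p : MvPolynomial σ ℝ) :
    restrictVars {j} (fun _ => s) (restrictVars J c p) =
      restrictVars (insert j J) (Function.update c j s) p := by
  rw [← AlgHom.comp_apply]
  congr 1
  ext1 k
  rw [AlgHom.comp_apply, restrictVars_X, restrictVars_X]
  by_cases hk : k = j
  · subst hk
    simp [hj, restrictVars_X]
  · by_cases hkJ : k ∈ J <;> simp [hk, hkJ, restrictVars_X]

theorem restrictVars_restrictVars (J : Finset σ) (c : σ → ℝ) (p : MvPolynomial σ ℝ) :
    restrictVars J c (restrictVars J c p) = restrictVars J c p := by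
  rw [← AlgHom.comp_apply]
  congr 1
  ext1 k
  rw [AlgHom.comp_apply, restrictVars_X]
  by_cases hk : k ∈ J <;> simp [hk, restrictVars_X]

theorem eval_restrictVars (J : Finset σ) (c z : σ → ℝ) (p : MvPolynomial σ ℝ) :
    eval z (restrictVars J c p) = eval (fun j => if j ∈ J then c j else z j) p := by
  rw [← coe_aeval_eq_eval, ← coe_aeval_eq_eval, RingHom.coe_coe, RingHom.coe_coe,
    ← AlgHom.comp_apply]
  congr 1
  ext1 k
  rw [AlgHom.comp_apply, restrictVars_X]
  by_cases hk : k ∈ J <;> simp [hk]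

theorem exists_of_mem_support_restrictVars (J : Finset σ) (c : σ → ℝ) {p : MvPolynomial σ ℝ}
    {β : σ →₀ ℕ} (hβ : β ∈ (restrictVars J c p).support) :
    (∀ j ∈ J, β j = 0) ∧ ∃ α ∈ p.support, ∀ j ∉ J, β j = α j := by
  rw [p.as_sum, map_sum] at hβ
  obtain ⟨α, hα, h⟩ := Finset.mem_biUnion.1 (support_sum hβ)
  have key : restrictVars J c (monomial α (p.coeff α)) =
      monomial (α.filter (· ∉ J)) (p.coeff α * (α.filter (· ∈ J)).prod fun j k => c j ^ k) := by
    rw [restrictVars, aeval_monomial, ← Finsupp.prod_filter_mul_prod_filter_not (· ∈ J),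
      algebraMap_eq, monomial_eq, C_mul, mul_assoc]
    congr 2
    · rw [Finsupp.prod, Finsupp.prod, map_prod]
      refine Finset.prod_congr rfl fun j hj => ?_
      have : j ∈ J := by
        rw [Finsupp.support_filter, Finset.mem_filter] at hj
        exact hj.2
      simp [this]
    · refine Finset.prod_congr rfl fun j hj => ?_
      have : j ∉ J := by
        rw [Finsupp.support_filter, Finset.mem_filter] at hj
        exact hj.2
      simp [this]
  rw [key] at h
  obtain rfl := Finset.mem_singleton.1 (support_monomial_subset h)
  exact ⟨fun j hj => by simp [hj], α, hα, fun j hj => by simp [hj]⟩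

theorem X_sub_C_dvd_sub_restrictVars (j : σ) (s : ℝ) (p : MvPolynomial σ ℝ) :
    X j - C s ∣ p - restrictVars {j} (fun _ => s) p := by
  induction p using MvPolynomial.induction_on with
  | C a => simp [restrictVars, algebraMap_eq]
  | add p q hp hq =>
    rw [map_add, add_sub_add_comm]
    exact dvd_add hp hq
  | mul_X p k hp =>
    have hk : X j - C s ∣ X k - restrictVars {j} (fun _ => s) (X k) := by
      rw [restrictVars_X]
      by_cases h : k = j <;> simp [h]
    rw [map_mul]
    have hsplit (a b a' b' : MvPolynomial σ ℝ) :
        a * b - a' * b' = (a - a') * b + a' * (b - b') := by ring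
    rw [hsplit]
    exact dvd_add (hp.mul_right _) (hk.mul_left _)

theorem prod_X_sub_C_dvd (T : Finset σ) (p : MvPolynomial σ ℝ)
    (h : ∀ j ∈ T, restrictVars {j} (fun _ => 1) p = 0 ∧ restrictVars {j} (fun _ => -1) p = 0) :
    (∏ j ∈ T, (X j - C (1 : ℝ)) * (X j - C (-1))) ∣ p := by
  induction T using Finset.induction_on with
  | empty => simp
  | insert j T hj ih =>
    obtain ⟨q, hq⟩ := ih fun k hk => h k (Finset.mem_insert_of_mem hk)
    have hb (s : ℝ) : restrictVars {j} (fun _ => s)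
        (∏ k ∈ T, (X k - C (1 : ℝ)) * (X k - C (-1))) =
        ∏ k ∈ T, (X k - C (1 : ℝ)) * (X k - C (-1)) := by
      rw [map_prod]
      refine Finset.prod_congr rfl fun k hk => ?_
      have hkj : k ≠ j := fun e => hj (e ▸ hk)
      simp [restrictVars, hkj]
    have hX (s : ℝ) (k : σ) : (X k - C s : MvPolynomial σ ℝ) ≠ 0 := fun e => by
      have := congrArg (eval fun _ => s + 1) e
      simp at this
    have hb0 : (∏ k ∈ T, (X k - C (1 : ℝ)) * (X k - C (-1)) : MvPolynomial σ ℝ) ≠ 0 :=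
      Finset.prod_ne_zero_iff.2 fun k _ => mul_ne_zero (hX _ _) (hX _ _)
    have hq0 (s : ℝ) (hs : restrictVars {j} (fun _ => s) p = 0) :
        restrictVars {j} (fun _ => s) q = 0 := by
      rw [hq, map_mul, hb] at hs
      exact (mul_eq_zero.1 hs).resolve_left hb0
    obtain ⟨h1, h2⟩ := h j (Finset.mem_insert_self _ _)
    obtain ⟨q₁, rfl⟩ : X j - C (1 : ℝ) ∣ q := by
      simpa [hq0 1 h1] using X_sub_C_dvd_sub_restrictVars j 1 q
    have h3 : restrictVars {j} (fun _ => (-1 : ℝ)) q₁ = 0 := by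
      have h4 := hq0 (-1) h2
      rw [map_mul] at h4
      refine (mul_eq_zero.1 h4).resolve_left fun e => ?_
      have := congrArg (eval fun _ => (0 : ℝ)) e
      rw [eval_restrictVars] at this
      norm_num at this
    obtain ⟨q₂, rfl⟩ : X j - C (-1 : ℝ) ∣ q₁ := by
      have := X_sub_C_dvd_sub_restrictVars j (-1) q₁
      rwa [h3, sub_zero] at this
    refine ⟨q₂, ?_⟩
    rw [hq, Finset.prod_insert hj]
    ring

theorem slDeg_le_of_mem_support_restrictVars [Fintype σ] (J : Finset σ) (c : σ → ℝ) {r : ℕ}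
    {p : MvPolynomial σ ℝ} (hp : ∀ α ∈ p.support, slDeg α ≤ r)
    {β : σ →₀ ℕ} (hβ : β ∈ (restrictVars J c p).support) : slDeg β ≤ r := by
  obtain ⟨h0, α, hα, h⟩ := exists_of_mem_support_restrictVars J c hβ
  refine le_trans (Finset.sum_le_sum fun j _ => ?_) (hp α hα)
  by_cases hj : j ∈ J
  · simp [h0 j hj]
  · rw [h j hj]

end Restriction

/-- Multiplication by the bubble `∏ j ∈ Jᶜ, (X j ^ 2 - 1)` turns degree into superlinear degree. -/
theorem totalDegree_add_le_of_slDeg_le {σ : Type*} [Fintype σ] [LinearOrder σ]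
    (J : Finset σ) {r : ℕ} {v : MvPolynomial σ ℝ} (hv : v ≠ 0)
    (hvJ : ∀ α ∈ v.support, ∀ j ∈ J, α j = 0)
    (h : ∀ α ∈ ((∏ j ∈ Jᶜ, (X j - C (1 : ℝ)) * (X j - C (-1))) * v).support, slDeg α ≤ r) :
    v.totalDegree + 2 * Jᶜ.card ≤ r := by
  let m : MonomialOrder σ := MonomialOrder.degLex
  have hX (s : ℝ) (k : σ) : (X k - C s : MvPolynomial σ ℝ) ≠ 0 := fun e => by
    have := congrArg (eval fun _ => s + 1) e
    simp at this
  have hb (j : σ) : (X j - C (1 : ℝ)) * (X j - C (-1)) ≠ 0 := mul_ne_zero (hX _ _) (hX _ _)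
  have hb0 : (∏ j ∈ Jᶜ, (X j - C (1 : ℝ)) * (X j - C (-1)) : MvPolynomial σ ℝ) ≠ 0 :=
    Finset.prod_ne_zero_iff.2 fun k _ => hb k
  have hdeg : m.degree ((∏ j ∈ Jᶜ, (X j - C (1 : ℝ)) * (X j - C (-1))) * v) =
      ∑ j ∈ Jᶜ, Finsupp.single j 2 + m.degree v := by
    rw [MonomialOrder.degree_mul hb0 hv, MonomialOrder.degree_prod fun j _ => hb j]
    congr 1
    refine Finset.sum_congr rfl fun j _ => ?_
    rw [MonomialOrder.degree_mul (hX _ _) (hX _ _), MonomialOrder.degree_X_sub_C,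
      MonomialOrder.degree_X_sub_C, ← Finsupp.single_add]
  refine le_trans (le_of_eq ?_) (h _ (m.degree_mem_support (mul_ne_zero hb0 hv)))
  rw [hdeg, ← degree_degLexDegree, Finsupp.degree_eq_sum, slDeg]
  have hcard : 2 * Jᶜ.card = ∑ j, if j ∈ J then 0 else 2 := by
    rw [Finset.sum_ite, Finset.sum_const_zero, zero_add, Finset.sum_const, smul_eq_mul, mul_comm]
    congr 2
    ext
    simp
  rw [hcard, ← Finset.sum_add_distrib]
  refine Finset.sum_congr rfl fun k _ => ?_
  have hs : (∑ j ∈ Jᶜ, Finsupp.single j 2 : σ →₀ ℕ) k = if k ∈ J then 0 else 2 := by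
    rw [Finsupp.finsetSum_apply]
    simp [Finsupp.single_apply]
  rw [Finsupp.add_apply, hs]
  by_cases hk : k ∈ J
  · have : m.degree v k = 0 := hvJ _ (m.degree_mem_support hv) k hk
    simpa [hk, m] using fun _ => this
  · simp [hk, m, add_comm]

/-- A polynomial in the variables outside `J` is zero if its square, weighted by the bubble,
has zero integral over the cube. -/
theorem eq_zero_of_integral_bubble_mul_sq {σ : Type*} [Fintype σ] [DecidableEq σ]
    (J : Finset σ) (c : σ → ℝ) (v : MvPolynomial σ ℝ) (hv : restrictVars J c v = v)
    (h : ∫ y in (Set.Icc (fun _ => (-1 : ℝ)) (fun _ => 1) : Set ({j : σ // j ∉ J} → ℝ)),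
      (∏ j, (1 - y j ^ 2)) * eval (fun j => if h : j ∈ J then c j else y ⟨j, h⟩) v ^ 2 = 0) :
    v = 0 := by
  set f : ({j : σ // j ∉ J} → ℝ) → ℝ := fun y =>
    (∏ j, (1 - y j ^ 2)) * eval (fun j => if h : j ∈ J then c j else y ⟨j, h⟩) v ^ 2 with hf
  have hcont : Continuous f := by
    refine (continuous_finsetProd _ fun j _ => by fun_prop).mul (Continuous.pow ?_ 2)
    refine (MvPolynomial.continuous_eval v).comp (continuous_pi fun j => ?_)
    by_cases hj : j ∈ J
    · simpa [hj] using continuous_const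
    · simpa [hj] using continuous_apply _
  have hnonneg : ∀ y ∈ (Set.Icc (fun _ => (-1 : ℝ)) (fun _ => 1) :
      Set ({j : σ // j ∉ J} → ℝ)), 0 ≤ f y := fun y hy =>
    mul_nonneg (Finset.prod_nonneg fun j _ => by nlinarith [hy.1 j, hy.2 j]) (sq_nonneg _)
  rw [setIntegral_eq_zero_iff_of_nonneg_ae
    ((ae_restrict_iff' measurableSet_Icc).2 (Filter.Eventually.of_forall hnonneg))
    (hcont.continuousOn.integrableOn_compact isCompact_Icc)] at h
  have hsub : Set.pi Set.univ (fun _ => Set.Ioo (-1 : ℝ) 1) ⊆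
      (Set.Icc (fun _ => (-1 : ℝ)) (fun _ => 1) : Set ({j : σ // j ∉ J} → ℝ)) :=
    fun y hy => ⟨fun j => (hy j trivial).1.le, fun j => (hy j trivial).2.le⟩
  have heq := Measure.eqOn_open_of_ae_eq (ae_restrict_of_ae_restrict_of_subset hsub h)
    (isOpen_set_pi Set.finite_univ fun _ _ => isOpen_Ioo) hcont.continuousOn continuousOn_const
  refine funext_set (fun _ => Set.Ioo (-1 : ℝ) 1) (fun _ => Set.Ioo_infinite (by norm_num))
    fun z hz => ?_
  have h0 := heq (x := fun j => z j) fun j _ => hz j trivial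
  have hpos : 0 < ∏ j : {j : σ // j ∉ J}, (1 - z j ^ 2) :=
    Finset.prod_pos fun j _ => by nlinarith [(hz j trivial).1, (hz j trivial).2]
  have h1 := pow_eq_zero_iff two_ne_zero |>.1 ((mul_eq_zero.1 h0).resolve_left hpos.ne')
  rw [← hv, eval_restrictVars, map_zero]
  simpa using h1

/-- Vanishing of the moments over a face and of the restrictions to its facets forces the
restriction to the face to vanish. -/
theorem restrictVars_eq_zero_of_facets {σ : Type*} [Fintype σ] [LinearOrder σ]
    (J : Finset σ) (c : σ → ℝ) {r : ℕ} {u : MvPolynomial σ ℝ}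
    (hu : ∀ α ∈ u.support, slDeg α ≤ r)
    (hfacet : ∀ j ∉ J, ∀ s : ℝ, s = 1 ∨ s = -1 →
      restrictVars (insert j J) (Function.update c j s) u = 0)
    (hmom : ∀ q : MvPolynomial σ ℝ, (∀ α ∈ q.support, ∀ j ∈ J, α j = 0) →
      q.totalDegree + 2 * Jᶜ.card ≤ r →
      ∫ y in (Set.Icc (fun _ => (-1 : ℝ)) (fun _ => 1) : Set ({j : σ // j ∉ J} → ℝ)),
        eval (fun j => if h : j ∈ J then c j else y ⟨j, h⟩) (u * q) = 0) :
    restrictVars J c u = 0 := by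
  obtain ⟨v₀, hv₀⟩ := prod_X_sub_C_dvd Jᶜ (restrictVars J c u) fun j hj => by
    rw [Finset.mem_compl] at hj
    rw [restrictVars_singleton_restrictVars J c hj, restrictVars_singleton_restrictVars J c hj]
    exact ⟨hfacet j hj 1 (.inl rfl), hfacet j hj (-1) (.inr rfl)⟩
  obtain ⟨v, hvv, hv⟩ : ∃ v, restrictVars J c v = v ∧ restrictVars J c u =
      (∏ j ∈ Jᶜ, (X j - C (1 : ℝ)) * (X j - C (-1))) * v := by
    refine ⟨restrictVars J c v₀, restrictVars_restrictVars _ _ _, ?_⟩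
    rw [← restrictVars_restrictVars, hv₀, map_mul, map_prod]
    congr 1
    refine Finset.prod_congr rfl fun j hj => ?_
    rw [Finset.mem_compl] at hj
    simp [restrictVars, hj]
  by_cases hv0 : v = 0
  · rw [hv, hv0, mul_zero]
  have hvJ : ∀ α ∈ v.support, ∀ j ∈ J, α j = 0 := fun α hα => by
    rw [← hvv] at hα
    exact (exists_of_mem_support_restrictVars J c hα).1
  have hdeg := totalDegree_add_le_of_slDeg_le J hv0 hvJ (r := r) fun α hα =>
    slDeg_le_of_mem_support_restrictVars J c hu (hv ▸ hα)
  refine absurd (eq_zero_of_integral_bubble_mul_sq J c v hvv ?_) hv0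
  rw [← mul_eq_zero_iff_left (pow_ne_zero Jᶜ.card (neg_ne_zero.2 (one_ne_zero' ℝ))),
    ← integral_const_mul, ← hmom v hvJ hdeg]
  congr 1
  funext y
  set z : σ → ℝ := fun j => if h : j ∈ J then c j else y ⟨j, h⟩ with hz
  have hzu : eval z u = eval z (restrictVars J c u) := by
    rw [eval_restrictVars]
    congr 2
    funext j
    by_cases hj : j ∈ J <;> simp [hz, hj]
  have hprod : ∏ j ∈ Jᶜ, (z j - 1) * (z j - -1) =
      (∏ j, (1 - y j ^ 2)) * (-1) ^ Jᶜ.card := by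
    rw [← Finset.prod_const, ← Finset.prod_subtype Jᶜ (fun j => Finset.mem_compl)
      (fun j => 1 - z j ^ 2) |>.trans (Finset.prod_congr rfl fun j _ => by simp [hz, j.2]),
      ← Finset.prod_mul_distrib]
    exact Finset.prod_congr rfl fun j _ => by ring
  rw [map_mul, hzu, hv, map_mul, map_prod]
  simp only [map_mul, map_sub, eval_X, eval_C]
  rw [hprod]
  ring

end MvPolynomial

/-- Face-restriction determination (continuity of assembled serendipity functions).
Let `u` have superlinear degree at most `r` and let `F` be the face `{x : x i = c}`
of `[-1,1]^n` of dimension `n-1`.  If all serendipity moments of `u` associated to the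
faces of `[-1,1]^n` contained in `F` (i.e. those given by `(J, c')` with `i ∈ J` and
`c' i = c`, tested against polynomials `q` in the free variables of total degree at
most `r - 2d`, `d = n - #J`) vanish, then the restriction of `u` to `F` is zero, i.e.
substituting `x i = c` into `u` yields the zero polynomial. -/
theorem face_restriction_zero (n r : ℕ) (hn : 2 ≤ n) (hr : 1 ≤ r)
    (u : MvPolynomial (Fin n) ℝ) (hu : ∀ α ∈ u.support, slDeg α ≤ r)
    (i : Fin n) (c : ℝ) (hc : c = 1 ∨ c = -1)
    (hmom : ∀ (J : Finset (Fin n)) (c' : Fin n → ℝ),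
      (∀ j ∈ J, c' j = 1 ∨ c' j = -1) → i ∈ J → c' i = c →
      ∀ q : MvPolynomial (Fin n) ℝ,
        (∀ α ∈ q.support, ∀ j ∈ J, α j = 0) →
        (q.totalDegree : ℤ) ≤ (r : ℤ) - 2 * ((n : ℤ) - J.card) →
        ∫ y in (Set.Icc (fun _ => (-1 : ℝ)) (fun _ => 1) : Set ({j : Fin n // j ∉ J} → ℝ)),
          MvPolynomial.eval (fun j => if h : j ∈ J then c' j else y ⟨j, h⟩) (u * q) = 0) :
    MvPolynomial.aeval
      (fun j : Fin n => if j = i then MvPolynomial.C c else MvPolynomial.X j) u = 0 := by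
  have key (d : ℕ) : ∀ (J : Finset (Fin n)) (c' : Fin n → ℝ), Jᶜ.card = d →
      (∀ j ∈ J, c' j = 1 ∨ c' j = -1) → i ∈ J → c' i = c →
      MvPolynomial.restrictVars J c' u = 0 := by
    induction d with
    | zero =>
      intro J c' hd hc' hi hci
      refine MvPolynomial.restrictVars_eq_zero_of_facets J c' hu (fun j hj => ?_) fun q hq hr => ?_
      · exact absurd (Finset.mem_compl.2 hj) (by simp [Finset.card_eq_zero.1 hd])
      · refine hmom J c' hc' hi hci q hq ?_
        have := J.card_add_card_compl
        rw [Fintype.card_fin] at this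
        omega
    | succ d ih =>
      intro J c' hd hc' hi hci
      refine MvPolynomial.restrictVars_eq_zero_of_facets J c' hu (fun j hj s hs => ?_)
        fun q hq hr => ?_
      · have hij : i ≠ j := fun e => hj (e ▸ hi)
        refine ih _ _ ?_ (fun k hk => ?_) (Finset.mem_insert_of_mem hi) (by simp [hij, hci])
        · rw [Finset.compl_insert, Finset.card_erase_of_mem (Finset.mem_compl.2 hj), hd]
          rfl
        · by_cases hkj : k = j
          · simpa [hkj] using hs
          · simpa [hkj] using hc' k (Finset.mem_of_mem_insert_of_ne hk hkj)
      · refine hmom J c' hc' hi hci q hq ?_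
        have := J.card_add_card_compl
        rw [Fintype.card_fin] at this
        omega
  simpa [MvPolynomial.restrictVars] using
    key _ {i} (fun _ => c) rfl (fun _ _ => hc) (Finset.mem_singleton_self i) rfl
end
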